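/- There is a constant C > 0, independent of T, ψ and v, with the following property. Let ψ : [0,T]×ℝ³ → ℝ and v : [0,T]×ℝ³ → ℝ³ be smooth, Schwartz in the space variable for each t, with div v = 0 and satisfying the transport equation ∂_tψ + v·∇ψ + v₃ = 0 on [0,T]×ℝ³. Then |∫₀^T∫_{ℝ³} ∂₃ψ · ∂₃v₃ · (∂₃³ψ)² dx dt| ≤ C B_T⁴ (1 + B_T). -/

import Mathlib

open MeasureTheory Real Set Filter
open scoped ENNReal NNReal

noncomputable section

/-- Spatial points of `ℝ³`. -/
abbrev Pt : Type := Fin 3 → ℝ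

/-- Partial derivative in the `i`-th coordinate direction. -/
def pd (i : Fin 3) (f : Pt → ℝ) : Pt → ℝ := fun x => fderiv ℝ f x (Pi.single i 1)

/-- Iterated partial derivative `∂^α` for a multi-index `α`. -/
def pdM (α : Fin 3 → ℕ) (f : Pt → ℝ) : Pt → ℝ :=
  (pd 0)^[α 0] ((pd 1)^[α 1] ((pd 2)^[α 2] f))

/-- Multi-indices of total degree at most `k`. -/
def midx (k : ℕ) : Finset (Fin 3 → ℕ) :=
  (Fintype.piFinset fun _ => Finset.range (k + 1)).filter fun α => ∑ i, α i ≤ k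

/-- The `H^k` inner product `(f|g)_{H^k} = ∑_{|α| ≤ k} ∫ ∂^α f ∂^α g`. -/
def hInner (k : ℕ) (f g : Pt → ℝ) : ℝ := ∑ α ∈ midx k, ∫ x : Pt, pdM α f x * pdM α g x

/-- The squared `H^k` norm. -/
def hSq (k : ℕ) (f : Pt → ℝ) : ℝ := hInner k f f

/-- The squared `L²` norm. -/
def l2Sq (f : Pt → ℝ) : ℝ := ∫ x : Pt, (f x) ^ 2

/-- The Laplacian. -/
def lapl (f : Pt → ℝ) : Pt → ℝ := fun x => ∑ i, pd i (pd i f) x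

/-- Horizontal directions. -/
def hIdx : Finset (Fin 3) := {0, 1}

/-- `L^∞` norm in time over `[0,T]` of a (nonnegative) function of time. -/
def supT (T : ℝ) (g : ℝ → ℝ) : ℝ := sSup (g '' Icc 0 T)

/-- `L²` norm in time over `[0,T]`. -/
def l2T (T : ℝ) (g : ℝ → ℝ) : ℝ := Real.sqrt (∫ t in (0:ℝ)..T, (g t) ^ 2)

/-- `L⁴` norm in time over `[0,T]`. -/
def l4T (T : ℝ) (g : ℝ → ℝ) : ℝ := (∫ t in (0:ℝ)..T, (g t) ^ 4) ^ ((1:ℝ)/4)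

/-- A function is Schwartz: smooth with all derivatives rapidly decaying. -/
def IsSchwartz (f : Pt → ℝ) : Prop :=
  ContDiff ℝ (⊤ : ℕ∞) f ∧ ∀ k n : ℕ, ∃ C : ℝ, ∀ x, ‖x‖ ^ k * ‖iteratedFDeriv ℝ n f x‖ ≤ C

/-- Smoothness of `f` jointly in `(t,x)` on `s ×ˢ ℝ³`. -/
def SmoothOn2 (s : Set ℝ) (f : ℝ → Pt → ℝ) : Prop :=
  ContDiffOn ℝ (⊤ : ℕ∞) (fun q : ℝ × Pt => f q.1 q.2) (s ×ˢ (univ : Set Pt))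

/-- `‖∇f‖_{H^k}²`. -/
def gradHSq (k : ℕ) (f : Pt → ℝ) : ℝ := ∑ i, hSq k (pd i f)

/-- `‖∇_h∇f‖_{H^k}²`. -/
def gradHHSq (k : ℕ) (f : Pt → ℝ) : ℝ := ∑ i ∈ hIdx, ∑ j, hSq k (pd i (pd j f))

/-- `‖v‖_{H^k}²` for a vector field. -/
def vecHSq (k : ℕ) (v : Fin 3 → Pt → ℝ) : ℝ := ∑ j, hSq k (v j)

/-- `‖∇v‖_{H^k}²` for a vector field. -/
def gradVecHSq (k : ℕ) (v : Fin 3 → Pt → ℝ) : ℝ := ∑ j, gradHSq k (v j)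

/-- `B_T²`. -/
def BTsq (T : ℝ) (ψ : ℝ → Pt → ℝ) (v : Fin 3 → ℝ → Pt → ℝ) : ℝ :=
  (supT T fun t => Real.sqrt (vecHSq 2 fun j => v j t)) ^ 2
  + (supT T fun t => Real.sqrt (gradHSq 2 (ψ t))) ^ 2
  + (l2T T fun t => Real.sqrt (gradVecHSq 2 fun j => v j t)) ^ 2
  + (l2T T fun t => Real.sqrt (gradHHSq 1 (ψ t))) ^ 2

/-- `B_T`. -/
def BT (T : ℝ) (ψ : ℝ → Pt → ℝ) (v : Fin 3 → ℝ → Pt → ℝ) : ℝ := Real.sqrt (BTsq T ψ v)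

/-- The transport equation `∂_tψ + v·∇ψ + v₃ = 0` on `s × ℝ³`. -/
def TransportEq (s : Set ℝ) (ψ : ℝ → Pt → ℝ) (v : Fin 3 → ℝ → Pt → ℝ) : Prop :=
  ∀ t ∈ s, ∀ x, deriv (fun τ => ψ τ x) t + (∑ i, v i t x * pd i (ψ t) x) + v 2 t x = 0

/-- Divergence-free condition on `s × ℝ³`. -/
def DivFree (s : Set ℝ) (v : Fin 3 → ℝ → Pt → ℝ) : Prop :=
  ∀ t ∈ s, ∀ x, (∑ i, pd i (fun y => v i t y) x) = 0

/-- The momentum equations of system (S) on `s × ℝ³`. -/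
def MomentumEq (s : Set ℝ) (ψ : ℝ → Pt → ℝ) (v : Fin 3 → ℝ → Pt → ℝ)
    (p : ℝ → Pt → ℝ) : Prop :=
  ∀ j : Fin 3, ∀ t ∈ s, ∀ x,
    deriv (fun τ => v j τ x) t + (∑ i, v i t x * pd i (v j t) x) - lapl (v j t) x
      + pd j (p t) x + pd j (pd 2 (ψ t)) x + (if j = 2 then lapl (ψ t) x else 0)
    = - ∑ i, pd i (fun y => pd j (ψ t) y * pd i (ψ t) y) x

/-- The full system (S) on `s × ℝ³`. -/
def SolvesS (s : Set ℝ) (ψ : ℝ → Pt → ℝ) (v : Fin 3 → ℝ → Pt → ℝ)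
    (p : ℝ → Pt → ℝ) : Prop :=
  TransportEq s ψ v ∧ MomentumEq s ψ v p ∧ DivFree s v

/-- Finiteness of the four norms entering `B_T`. -/
def FiniteClass (T : ℝ) (ψ : ℝ → Pt → ℝ) (v : Fin 3 → ℝ → Pt → ℝ) : Prop :=
  BddAbove ((fun t => Real.sqrt (vecHSq 2 fun j => v j t)) '' Icc 0 T) ∧
  BddAbove ((fun t => Real.sqrt (gradHSq 2 (ψ t))) '' Icc 0 T) ∧
  IntervalIntegrable (fun t => gradVecHSq 2 fun j => v j t) volume 0 T ∧
  IntervalIntegrable (fun t => gradHHSq 1 (ψ t)) volume 0 T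

namespace IsSchwartz

open SchwartzMap

variable {f g : Pt → ℝ}

/-- The bundled Schwartz map of a function satisfying `IsSchwartz`. -/
def toMap (hf : IsSchwartz f) : 𝓢(Pt, ℝ) := ⟨f, hf.1, hf.2⟩

lemma ofMap (s : 𝓢(Pt, ℝ)) : IsSchwartz (fun x => s x) := ⟨s.smooth', s.decay'⟩

lemma pd (hf : IsSchwartz f) (i : Fin 3) : IsSchwartz (pd i f) :=
  ofMap (LineDeriv.lineDerivOp (Pi.single i (1 : ℝ) : Pt) hf.toMap)

lemma mul (hf : IsSchwartz f) (hg : IsSchwartz g) : IsSchwartz (fun x => f x * g x) :=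
  ofMap (pairing (ContinuousLinearMap.mul ℝ ℝ) hf.toMap hg.toMap)

lemma add (hf : IsSchwartz f) (hg : IsSchwartz g) : IsSchwartz (fun x => f x + g x) :=
  ofMap (hf.toMap + hg.toMap)

lemma const_mul (hf : IsSchwartz f) (c : ℝ) : IsSchwartz (fun x => c * f x) :=
  ofMap (c • hf.toMap)

lemma zero : IsSchwartz (fun _ => (0 : ℝ)) := ofMap 0

lemma sum {ι : Type*} (s : Finset ι) {F : ι → Pt → ℝ} (h : ∀ i ∈ s, IsSchwartz (F i)) :
    IsSchwartz (fun x => ∑ i ∈ s, F i x) := by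
  classical
  induction s using Finset.induction_on with
  | empty => simpa using zero
  | insert a s ha ih =>
    simp only [Finset.sum_insert ha]
    exact (h a (Finset.mem_insert_self _ _)).add
      (ih fun i hi => h i (Finset.mem_insert_of_mem hi))

lemma sq (hf : IsSchwartz f) : IsSchwartz (fun x => f x ^ 2) := by
  simpa only [pow_two] using hf.mul hf

lemma integrable (hf : IsSchwartz f) : Integrable f := hf.toMap.integrable

lemma differentiable (hf : IsSchwartz f) : Differentiable ℝ f :=
  hf.1.differentiable (by simp)

lemma continuous (hf : IsSchwartz f) : Continuous f := hf.1.continuous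

lemma bounded (hf : IsSchwartz f) : ∃ C, 0 ≤ C ∧ ∀ x, |f x| ≤ C := by
  obtain ⟨C, hC⟩ := hf.2 0 0
  refine ⟨C, ?_, fun x => by simpa using hC x⟩
  simpa using (abs_nonneg (f 0)).trans (by simpa using hC 0)

lemma of_hasCompactSupport (h : HasCompactSupport f) (hf : ContDiff ℝ (⊤ : ℕ∞) f) :
    IsSchwartz f :=
  ofMap (h.toSchwartzMap hf)

lemma integral_pd (hf : IsSchwartz f) (i : Fin 3) : ∫ x, _root_.pd i f x = 0 := by
  have := integral_mul_fderiv_eq_neg_fderiv_mul_of_integrable (μ := (volume : Measure Pt))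
    (𝕜 := ℝ) (f := fun _ : Pt => (1 : ℝ)) (g := f) (v := Pi.single i 1) (by simp)
    (by simp only [one_mul]; exact (hf.pd i).integrable)
    (by simpa using hf.integrable)
    (fun x _ => differentiableAt_const _) (fun x _ => hf.differentiable x)
  simpa [_root_.pd] using this

end IsSchwartz

lemma ContDiff.pd {f : Pt → ℝ} (hf : ContDiff ℝ (⊤ : ℕ∞) f) (i : Fin 3) :
    ContDiff ℝ (⊤ : ℕ∞) (pd i f) :=
  (hf.fderiv_right (m := (⊤ : ℕ∞)) (by simp)).clm_apply contDiff_const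

lemma pd_mul {f g : Pt → ℝ} (hf : Differentiable ℝ f) (hg : Differentiable ℝ g) (i : Fin 3) :
    pd i (fun x => f x * g x) = fun x => pd i f x * g x + f x * pd i g x := by
  funext x
  simp only [pd]
  rw [fderiv_fun_mul (hf x) (hg x)]
  simp
  ring

lemma pd_add {f g : Pt → ℝ} (hf : Differentiable ℝ f) (hg : Differentiable ℝ g) (i : Fin 3) :
    pd i (fun x => f x + g x) = fun x => pd i f x + pd i g x := by
  funext x
  simp only [pd]
  rw [fderiv_fun_add (hf x) (hg x)]
  simp

lemma pd_neg {f : Pt → ℝ} (i : Fin 3) :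
    pd i (fun x => - f x) = fun x => - pd i f x := by
  funext x
  simp [pd]

lemma pd_const_mul {f : Pt → ℝ} (hf : Differentiable ℝ f) (c : ℝ) (i : Fin 3) :
    pd i (fun x => c * f x) = fun x => c * pd i f x := by
  funext x
  simp only [pd]
  rw [fderiv_const_mul (hf x)]
  simp

lemma pd_sum {ι : Type*} (s : Finset ι) {F : ι → Pt → ℝ}
    (h : ∀ i ∈ s, Differentiable ℝ (F i)) (j : Fin 3) :
    pd j (fun x => ∑ i ∈ s, F i x) = fun x => ∑ i ∈ s, pd j (F i) x := by
  funext x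
  simp only [pd]
  rw [fderiv_fun_sum fun i hi => h i hi x]
  simp

lemma pd_comm {f : Pt → ℝ} (hf : ContDiff ℝ (⊤ : ℕ∞) f) (i j : Fin 3) :
    pd i (pd j f) = pd j (pd i f) := by
  funext x
  have hd : DifferentiableAt ℝ (fderiv ℝ f) x :=
    (hf.fderiv_right (m := (⊤ : ℕ∞)) (by simp)).differentiable (by simp) x
  have key : ∀ k l : Fin 3, pd k (pd l f) x
      = fderiv ℝ (fderiv ℝ f) x (Pi.single k 1) (Pi.single l 1) := by
    intro k l
    change fderiv ℝ (fun y => fderiv ℝ f y (Pi.single l 1)) x (Pi.single k 1) = _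
    rw [fderiv_clm_apply hd (differentiableAt_const _)]
    simp
  rw [key, key]
  exact (hf.contDiffAt.isSymmSndFDerivAt (by
    simpa using WithTop.coe_le_coe.2 (le_top : (2 : ℕ∞) ≤ ⊤))) _ _

/-- The `L²` norm. -/
def l2n (f : Pt → ℝ) : ℝ := Real.sqrt (l2Sq f)

lemma l2Sq_nonneg (f : Pt → ℝ) : 0 ≤ l2Sq f := integral_nonneg fun _ => sq_nonneg _

lemma l2n_nonneg (f : Pt → ℝ) : 0 ≤ l2n f := Real.sqrt_nonneg _

lemma l2n_sq (f : Pt → ℝ) : l2n f ^ 2 = l2Sq f := Real.sq_sqrt (l2Sq_nonneg f)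

/-- The Cauchy–Schwarz inequality for real functions. -/
lemma integral_abs_mul_le_sqrt {α : Type*} [MeasurableSpace α] {μ : Measure α} {f g : α → ℝ}
    (hf : MemLp f 2 μ) (hg : MemLp g 2 μ) :
    ∫ x, |f x * g x| ∂μ ≤ Real.sqrt (∫ x, f x ^ 2 ∂μ) * Real.sqrt (∫ x, g x ^ 2 ∂μ) := by
  have h := integral_mul_le_Lp_mul_Lq_of_nonneg (μ := μ) (p := 2) (q := 2)
    Real.HolderConjugate.two_two (f := fun x => |f x|) (g := fun x => |g x|)
    (ae_of_all _ fun _ => abs_nonneg _) (ae_of_all _ fun _ => abs_nonneg _)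
    (by rw [ENNReal.ofReal_ofNat]; exact hf.abs) (by rw [ENNReal.ofReal_ofNat]; exact hg.abs)
  simpa [Real.sqrt_eq_rpow, abs_mul] using h

lemma IsSchwartz.memLp {f : Pt → ℝ} (hf : IsSchwartz f) : MemLp f 2 (volume : Measure Pt) :=
  hf.toMap.memLp 2 volume

lemma IsSchwartz.integral_abs_mul_le {f g : Pt → ℝ} (hf : IsSchwartz f) (hg : IsSchwartz g) :
    ∫ x, |f x * g x| ≤ l2n f * l2n g :=
  integral_abs_mul_le_sqrt hf.memLp hg.memLp

/-- A Gagliardo–Nirenberg inequality for second derivatives in one direction. -/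
lemma IsSchwartz.integral_pd_pow_four_le {f : Pt → ℝ} (hf : IsSchwartz f) (i : Fin 3) {S : ℝ}
    (hS : ∀ x, |f x| ≤ S) :
    ∫ x, (_root_.pd i f x ^ 2) ^ 2 ≤ 9 * S ^ 2 * l2Sq (_root_.pd i (_root_.pd i f)) := by
  have hp := hf.pd i
  have hq := hp.pd i
  set p := _root_.pd i f with hpdef
  set q := _root_.pd i p with hqdef
  have hS0 : 0 ≤ S := (abs_nonneg _).trans (hS 0)
  have h0 := (hf.mul (hp.mul (hp.mul hp))).integral_pd i
  rw [pd_mul hf.differentiable (hp.mul (hp.mul hp)).differentiable,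
    pd_mul hp.differentiable (hp.mul hp).differentiable,
    pd_mul hp.differentiable hp.differentiable, ← hpdef, ← hqdef] at h0
  have hI : Integrable fun x => (p x ^ 2) ^ 2 := hp.sq.sq.integrable
  have hJ : Integrable fun x => f x * (p x ^ 2 * q x) := (hf.mul (hp.sq.mul hq)).integrable
  have h1 : ∫ x, (p x ^ 2) ^ 2 = - (3 * ∫ x, f x * (p x ^ 2 * q x)) := by
    rw [← integral_const_mul, eq_neg_iff_add_eq_zero, ← integral_add hI (hJ.const_mul 3), ← h0]
    congr 1
    funext x
    ring
  have h2 : |∫ x, f x * (p x ^ 2 * q x)| ≤ S * ∫ x, |p x ^ 2 * q x| := by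
    rw [← integral_const_mul]
    refine (abs_integral_le_integral_abs).trans (integral_mono hJ.abs
      ((hp.sq.mul hq).integrable.abs.const_mul S) fun x => ?_)
    simp only [abs_mul (f x)]
    gcongr
    exact hS x
  have h3 := hp.sq.integral_abs_mul_le hq
  have h4 := l2n_sq fun x => p x ^ 2
  have h5 := l2n_sq q
  have h6 : l2Sq (fun x => p x ^ 2) = ∫ x, (p x ^ 2) ^ 2 := rfl
  set X := l2n fun x => p x ^ 2
  set Y := l2n q
  have h7 : ∫ x, (p x ^ 2) ^ 2 ≤ 3 * (S * (X * Y)) := by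
    have := neg_abs_le (∫ x, f x * (p x ^ 2 * q x))
    have := mul_le_mul_of_nonneg_left h3 hS0
    linarith
  nlinarith [sq_nonneg (X - 3 * S * Y)]

lemma integral_comp_mul_pi {D : Pt} (hD : ∀ i, 0 < D i) {g : Pt → ℝ} (hg : Continuous g) (x : Pt) :
    ∫ w, g (x + D * w) = (∏ i, D i)⁻¹ * ∫ y, g y := by
  have hprod : 0 < ∏ i, D i := Finset.prod_pos fun i _ => hD i
  have h := Real.smul_map_diagonal_volume_pi (D := D) (by simpa using hprod.ne')
  have hL : ∀ w : Pt, Matrix.toLin' (Matrix.diagonal D) w = D * w := fun w => by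
    funext i
    simp [Matrix.mulVec_diagonal]
  have h2 : ∫ y, g (x + y) = (∏ i, D i) * ∫ w, g (x + D * w) := by
    conv_lhs => rw [← h]
    rw [integral_smul_measure, integral_map]
    · simp [hL, abs_of_pos hprod, hprod.le]
    · exact (LinearMap.continuous_on_pi _).measurable.aemeasurable
    · exact (hg.comp (continuous_const.add continuous_id)).aestronglyMeasurable
  rw [integral_add_left_eq_self] at h2
  rw [h2]
  field_simp

/-- The unit cube. -/
def cube : Set Pt := Icc 0 1

lemma volume_cube : (volume : Measure Pt) cube = 1 := by
  simp [cube, Real.volume_Icc_pi]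

lemma setIntegral_cube_le {G : Pt → ℝ} (hG : IsSchwartz G) {D : Pt} (hD : ∀ i, 0 < D i) (x : Pt) :
    ∫ w in cube, |G (x + D * w)| ≤ Real.sqrt ((∏ i, D i)⁻¹) * l2n G := by
  have hc : Continuous fun w : Pt => G (x + D * w) := by
    have := hG.continuous
    fun_prop
  have : IsFiniteMeasure ((volume : Measure Pt).restrict cube) :=
    ⟨by simp [volume_cube]⟩
  obtain ⟨C, -, hC⟩ := hG.bounded
  have hm : MemLp (fun w : Pt => G (x + D * w)) 2 (volume.restrict cube) :=
    MemLp.of_bound hc.aestronglyMeasurable C (ae_of_all _ fun w => hC _)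
  have h := integral_abs_mul_le_sqrt hm (memLp_const (1 : ℝ))
  have hprod : 0 < ∏ i, D i := Finset.prod_pos fun i _ => hD i
  have hcv := integral_comp_mul_pi hD (g := fun y => G y ^ 2) (hG.continuous.pow 2) x
  have hintg : Integrable fun w : Pt => G (x + D * w) ^ 2 := by
    by_contra hn
    have h0 : ∫ y, G y ^ 2 = 0 := by
      rw [integral_undef hn] at hcv
      simpa [hprod.ne'] using hcv.symm
    have hz : ∀ y, G y = 0 := by
      have := (integral_eq_zero_iff_of_nonneg (fun y => sq_nonneg (G y)) hG.sq.integrable).1 h0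
      have := (Continuous.ae_eq_iff_eq volume (hG.continuous.pow 2) continuous_const).1 this
      exact fun y => pow_eq_zero_iff two_ne_zero |>.1 (congrFun this y)
    exact hn (by simp [hz])
  have h2 : ∫ w in cube, G (x + D * w) ^ 2 ≤ (∏ i, D i)⁻¹ * l2Sq G := by
    rw [l2Sq, ← hcv]
    exact setIntegral_le_integral hintg (ae_of_all _ fun _ => sq_nonneg _)
  have h3 : Real.sqrt (∫ w in cube, G (x + D * w) ^ 2) ≤ Real.sqrt ((∏ i, D i)⁻¹) * l2n G := by
    rw [l2n, ← Real.sqrt_mul (by positivity)]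
    exact Real.sqrt_le_sqrt h2
  refine le_trans ?_ h3
  simpa [volume_cube, Measure.real] using h

lemma setIntegral_cube_intervalIntegral_le {G : Pt → ℝ} (hG : IsSchwartz G) {d : Pt}
    (hd : ∀ i, 0 < d i) (x : Pt) :
    ∫ w in cube, ∫ r in (0 : ℝ)..1, r * |G (x + r • (d * w))| ≤
      2 * (Real.sqrt ((∏ i, d i)⁻¹) * l2n G) := by
  have hGc := hG.continuous
  have hK : IsCompact (Icc (0 : ℝ) 1 ×ˢ cube) := isCompact_Icc.prod isCompact_Icc
  have hcont : Continuous fun q : ℝ × Pt => q.1 * |G (x + q.1 • (d * q.2))| := by fun_prop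
  have hintg : Integrable (Function.uncurry fun (r : ℝ) (w : Pt) => r * |G (x + r • (d * w))|)
      ((volume.restrict (uIoc 0 1)).prod (volume.restrict cube)) := by
    rw [Measure.prod_restrict]
    refine (hcont.continuousOn.integrableOn_compact hK).mono_set (prod_mono ?_ subset_rfl)
    rw [uIoc_of_le zero_le_one]
    exact Ioc_subset_Icc_self
  rw [← intervalIntegral_integral_swap hintg]
  set K := Real.sqrt ((∏ i, d i)⁻¹) * l2n G with hKdef
  have hK0 : 0 ≤ K := mul_nonneg (Real.sqrt_nonneg _) (l2n_nonneg _)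
  have hb : ∀ r ∈ Ioc (0 : ℝ) 1,
      ∫ w in cube, r * |G (x + r • (d * w))| ≤ K * r ^ (-(1 / 2) : ℝ) := by
    intro r hr
    have hr0 := hr.1
    rw [integral_const_mul]
    have h := setIntegral_cube_le hG (D := r • d) (fun i => mul_pos hr0 (hd i)) x
    simp only [smul_mul_assoc] at h
    refine (mul_le_mul_of_nonneg_left h hr0.le).trans (le_of_eq ?_)
    have e1 : (∏ i, (r • d) i)⁻¹ = r ^ (-3 : ℝ) * (∏ i, d i)⁻¹ := by
      have : r ^ (-3 : ℝ) = (r ^ 3)⁻¹ := by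
        rw [Real.rpow_neg hr0.le]
        norm_cast
      rw [this]
      simp [Finset.prod_mul_distrib, mul_comm]
    rw [e1, Real.sqrt_mul (by positivity), Real.sqrt_eq_rpow, ← Real.rpow_mul hr0.le, hKdef]
    have e2 : r * r ^ (-3 * (1 / 2) : ℝ) = r ^ (-(1 / 2) : ℝ) := by
      nth_rw 1 [← Real.rpow_one r]
      rw [← Real.rpow_add hr0]
      norm_num
    rw [← e2, Real.sqrt_eq_rpow]
    ring
  have hI : IntervalIntegrable (fun r : ℝ => K * r ^ (-(1 / 2) : ℝ)) volume 0 1 :=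
    (intervalIntegral.intervalIntegrable_rpow' (by norm_num)).const_mul K
  have hI' : IntervalIntegrable (fun r : ℝ => ∫ w in cube, r * |G (x + r • (d * w))|)
      volume 0 1 := by
    rw [intervalIntegrable_iff]
    exact hintg.integral_prod_left
  refine (intervalIntegral.integral_mono_on_of_le_Ioo zero_le_one hI' hI fun r hr =>
    hb r (Ioo_subset_Ioc_self hr)).trans (le_of_eq ?_)
  rw [intervalIntegral.integral_const_mul, integral_rpow (by left; norm_num)]
  norm_num
  ring

lemma fderiv_apply_eq_sum_pd (G : Pt → ℝ) (y e : Pt) :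
    fderiv ℝ G y e = ∑ i, e i * pd i G y := by
  conv_lhs => rw [pi_eq_sum_univ' e]
  rw [map_sum]
  refine Finset.sum_congr rfl fun i _ => ?_
  rw [map_smul, smul_eq_mul, pd]

lemma hasDerivAt_comp_line {G : Pt → ℝ} (hG : Differentiable ℝ G) (x e : Pt) (r : ℝ) :
    HasDerivAt (fun r : ℝ => G (x + r • e)) (∑ i, e i * pd i G (x + r • e)) r := by
  have h1 : HasDerivAt (fun r : ℝ => x + r • e) e r := by
    simpa using ((hasDerivAt_id r).smul_const e).const_add x
  have := (hG (x + r • e)).hasFDerivAt.comp_hasDerivAt r h1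
  rwa [fderiv_apply_eq_sum_pd] at this

/-- Taylor representation of a function along a segment, with a cutoff. -/
lemma eq_intervalIntegral_line {f : Pt → ℝ} (hf : IsSchwartz f) (x e : Pt) :
    f x = ∫ r in (0 : ℝ)..1, r * (2 * f (x + r • e)
      - 4 * (1 - r) * (∑ i, e i * pd i f (x + r • e))
      + (1 - r) ^ 2 * ∑ i, e i * ∑ j, e j * pd j (pd i f) (x + r • e)) := by
  have hF := hasDerivAt_comp_line hf.differentiable x e
  have hF' : ∀ r, HasDerivAt (fun r : ℝ => ∑ i, e i * pd i f (x + r • e))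
      (∑ i, e i * ∑ j, e j * pd j (pd i f) (x + r • e)) r := fun r =>
    HasDerivAt.fun_sum fun i _ => (hasDerivAt_comp_line (hf.pd i).differentiable x e r).const_mul _
  have hH : ∀ r ∈ uIcc (0 : ℝ) 1, HasDerivAt
      (fun r : ℝ => r * (-(2 * (1 - r)) * f (x + r • e)
        + (1 - r) ^ 2 * ∑ i, e i * pd i f (x + r • e)) - (1 - r) ^ 2 * f (x + r • e))
      (r * (2 * f (x + r • e) - 4 * (1 - r) * (∑ i, e i * pd i f (x + r • e))
        + (1 - r) ^ 2 * ∑ i, e i * ∑ j, e j * pd j (pd i f) (x + r • e))) r := by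
    intro r _
    have h1 : HasDerivAt (fun r : ℝ => 1 - r) (-1) r := by
      simpa using (hasDerivAt_id r).const_sub 1
    have h2 : HasDerivAt (fun r : ℝ => (1 - r) ^ 2) (-(2 * (1 - r))) r := by
      refine (h1.pow 2).congr_deriv ?_
      simp
    refine (((hasDerivAt_id r).mul (((h1.const_mul 2).neg.mul (hF r)).add
      (h2.mul (hF' r)))).sub (h2.mul (hF r))).congr_deriv ?_
    simp only [id_eq, Pi.mul_apply, Pi.add_apply, Pi.neg_apply, one_mul]
    ring
  rw [intervalIntegral.integral_eq_sub_of_hasDerivAt hH]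
  · simp
  · refine Continuous.intervalIntegrable ?_ _ _
    have h0 := hf.continuous
    have h1 := fun i => (hf.pd i).continuous
    have h2 := fun i j => ((hf.pd i).pd j).continuous
    fun_prop

lemma abs_le_of_line {f : Pt → ℝ} (hf : IsSchwartz f) (x : Pt) {d w : Pt} (hd : ∀ i, 0 < d i)
    (hw : w ∈ cube) :
    |f x| ≤ 4 * ((∫ r in (0 : ℝ)..1, r * |f (x + r • (d * w))|)
      + (∑ i, d i * ∫ r in (0 : ℝ)..1, r * |pd i f (x + r • (d * w))|)
      + ∑ i, ∑ j, d i * d j * ∫ r in (0 : ℝ)..1, r * |pd j (pd i f) (x + r • (d * w))|) := by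
  have h0 := hf.continuous
  have h1 := fun i => (hf.pd i).continuous
  have h2 := fun i j => ((hf.pd i).pd j).continuous
  have hintg : ∀ {G : Pt → ℝ}, Continuous G → IntervalIntegrable
      (fun r : ℝ => r * |G (x + r • (d * w))|) volume 0 1 := fun hG =>
    Continuous.intervalIntegrable (by fun_prop) _ _
  have hsum : (∫ r in (0 : ℝ)..1, r * |f (x + r • (d * w))|)
      + (∑ i, d i * ∫ r in (0 : ℝ)..1, r * |pd i f (x + r • (d * w))|)
      + ∑ i, ∑ j, d i * d j * ∫ r in (0 : ℝ)..1, r * |pd j (pd i f) (x + r • (d * w))|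
      = ∫ r in (0 : ℝ)..1, (r * |f (x + r • (d * w))|
        + (∑ i, d i * (r * |pd i f (x + r • (d * w))|))
        + ∑ i, ∑ j, d i * d j * (r * |pd j (pd i f) (x + r • (d * w))|)) := by
    simp only [← intervalIntegral.integral_const_mul]
    rw [intervalIntegral.integral_add, intervalIntegral.integral_add,
      intervalIntegral.integral_finsetSum, intervalIntegral.integral_finsetSum]
    · congr 1
      refine Finset.sum_congr rfl fun i _ => ?_
      rw [intervalIntegral.integral_finsetSum]
      exact fun j _ => (hintg (h2 i j)).const_mul _
    all_goals
      intros
      exact Continuous.intervalIntegrable (by fun_prop) _ _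
  rw [hsum, ← intervalIntegral.integral_const_mul, eq_intervalIntegral_line hf x (d * w)]
  refine (intervalIntegral.abs_integral_le_integral_abs zero_le_one).trans
    (intervalIntegral.integral_mono_on zero_le_one ?_ ?_ fun r hr => ?_)
  · exact Continuous.intervalIntegrable (by fun_prop) _ _
  · exact Continuous.intervalIntegrable (by fun_prop) _ _
  · have he : ∀ i, |(d * w) i| ≤ d i := fun i => by
      rw [Pi.mul_apply, abs_mul, abs_of_pos (hd i), abs_of_nonneg (hw.1 i)]
      exact mul_le_of_le_one_right (hd i).le (hw.2 i)
    have hr0 := hr.1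
    have hr1 : 0 ≤ 1 - r := by linarith [hr.2]
    have hr2 : 1 - r ≤ 1 := by linarith
    have b1 : |∑ i, (d * w) i * pd i f (x + r • (d * w))|
        ≤ ∑ i, d i * |pd i f (x + r • (d * w))| := by
      refine (Finset.abs_sum_le_sum_abs _ _).trans (Finset.sum_le_sum fun i _ => ?_)
      rw [abs_mul]
      exact mul_le_mul_of_nonneg_right (he i) (abs_nonneg _)
    have b2 : |∑ i, (d * w) i * ∑ j, (d * w) j * pd j (pd i f) (x + r • (d * w))|
        ≤ ∑ i, ∑ j, d i * d j * |pd j (pd i f) (x + r • (d * w))| := by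
      refine (Finset.abs_sum_le_sum_abs _ _).trans (Finset.sum_le_sum fun i _ => ?_)
      rw [abs_mul]
      simp only [mul_assoc, ← Finset.mul_sum]
      refine mul_le_mul (he i) ((Finset.abs_sum_le_sum_abs _ _).trans
        (Finset.sum_le_sum fun j _ => ?_)) (abs_nonneg _) (hd i).le
      rw [abs_mul]
      exact mul_le_mul_of_nonneg_right (he j) (abs_nonneg _)
    have e1 : ∀ (a : ℝ) (b : Fin 3 → ℝ) (c : Fin 3 → Fin 3 → ℝ),
        4 * (r * a + (∑ i, d i * (r * b i)) + ∑ i, ∑ j, d i * d j * (r * c i j))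
        = r * (4 * a + 4 * (∑ i, d i * b i) + 4 * ∑ i, ∑ j, d i * d j * c i j) := by
      intro a b c
      simp only [Fin.sum_univ_three]
      ring
    rw [e1, abs_mul, abs_of_nonneg hr0]
    refine mul_le_mul_of_nonneg_left ?_ hr0
    set a := f (x + r • (d * w))
    set b := ∑ i, (d * w) i * pd i f (x + r • (d * w))
    set c := ∑ i, (d * w) i * ∑ j, (d * w) j * pd j (pd i f) (x + r • (d * w))
    refine (abs_add_le _ _).trans (add_le_add ((abs_sub _ _).trans (add_le_add ?_ ?_)) ?_)
    · rw [abs_mul, abs_two]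
      linarith [abs_nonneg a]
    · rw [abs_mul, abs_of_nonneg (by positivity)]
      have : (1 - r) * |b| ≤ 1 * |b| := mul_le_mul_of_nonneg_right hr2 (abs_nonneg _)
      linarith
    · rw [abs_mul, abs_of_nonneg (by positivity)]
      have : (1 - r) ^ 2 * |c| ≤ 1 * |c| :=
        mul_le_mul_of_nonneg_right (pow_le_one₀ hr1 hr2) (abs_nonneg _)
      linarith [abs_nonneg c]

lemma abs_le_of_scaling {f : Pt → ℝ} (hf : IsSchwartz f) (x : Pt) {d : Pt} (hd : ∀ i, 0 < d i) :
    |f x| ≤ 8 * Real.sqrt ((∏ i, d i)⁻¹) * (l2n f + (∑ i, d i * l2n (pd i f))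
      + ∑ i, ∑ j, d i * d j * l2n (pd j (pd i f))) := by
  have hJc : ∀ {G : Pt → ℝ}, IsSchwartz G → IntegrableOn
      (fun w => ∫ r in (0 : ℝ)..1, r * |G (x + r • (d * w))|) cube := by
    intro G hG
    have := hG.continuous
    refine Continuous.integrableOn_Icc ?_
    exact intervalIntegral.continuous_parametric_intervalIntegral_of_continuous' (by fun_prop) _ _
  have hJ0 := fun i => hJc (hf.pd i)
  have hJ1 := fun i j => hJc ((hf.pd i).pd j)
  have h1 : |f x| ≤ ∫ w in cube, 4 * ((∫ r in (0 : ℝ)..1, r * |f (x + r • (d * w))|)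
      + (∑ i, d i * ∫ r in (0 : ℝ)..1, r * |pd i f (x + r • (d * w))|)
      + ∑ i, ∑ j, d i * d j * ∫ r in (0 : ℝ)..1, r * |pd j (pd i f) (x + r • (d * w))|) := by
    have hc : |f x| = ∫ w in cube, |f x| := by simp [volume_cube, Measure.real]
    rw [hc]
    refine setIntegral_mono_on (by simp [volume_cube]) ?_ measurableSet_Icc
      fun w hw => abs_le_of_line hf x hd hw
    refine Integrable.const_mul (((hJc hf).add ?_).add ?_) 4
    · exact integrable_finsetSum _ fun i _ => (hJ0 i).const_mul _
    · exact integrable_finsetSum _ fun i _ =>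
        integrable_finsetSum _ fun j _ => (hJ1 i j).const_mul _
  refine h1.trans ?_
  rw [integral_const_mul, integral_add, integral_add (hJc hf), integral_finsetSum,
    integral_finsetSum]
  rotate_left
  · exact fun i _ => integrable_finsetSum _ fun j _ => (hJ1 i j).const_mul _
  · exact fun i _ => (hJ0 i).const_mul _
  · exact integrable_finsetSum _ fun i _ => (hJ0 i).const_mul _
  · exact (hJc hf).add (integrable_finsetSum _ fun i _ => (hJ0 i).const_mul _)
  · exact integrable_finsetSum _ fun i _ =>
        integrable_finsetSum _ fun j _ => (hJ1 i j).const_mul _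
  set κ := Real.sqrt ((∏ i, d i)⁻¹) with hκ
  have k0 := setIntegral_cube_intervalIntegral_le hf hd x
  have k1 : ∑ i, ∫ w in cube, d i * ∫ r in (0 : ℝ)..1, r * |pd i f (x + r • (d * w))|
      ≤ ∑ i, d i * (2 * (κ * l2n (pd i f))) := Finset.sum_le_sum fun i _ => by
    rw [integral_const_mul]
    exact mul_le_mul_of_nonneg_left (setIntegral_cube_intervalIntegral_le (hf.pd i) hd x) (hd i).le
  have k2 : ∑ i, ∫ w in cube, ∑ j, d i * d j *
      ∫ r in (0 : ℝ)..1, r * |pd j (pd i f) (x + r • (d * w))|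
      ≤ ∑ i, ∑ j, d i * d j * (2 * (κ * l2n (pd j (pd i f)))) := Finset.sum_le_sum fun i _ => by
    rw [integral_finsetSum _ fun j _ => (hJ1 i j).const_mul _]
    refine Finset.sum_le_sum fun j _ => ?_
    rw [integral_const_mul]
    exact mul_le_mul_of_nonneg_left (setIntegral_cube_intervalIntegral_le ((hf.pd i).pd j) hd x)
      (mul_pos (hd i) (hd j)).le
  refine (mul_le_mul_of_nonneg_left (add_le_add (add_le_add k0 k1) k2) (by norm_num)).trans
    (le_of_eq ?_)
  simp only [Fin.sum_univ_three]
  ring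

/-- Anisotropic Sobolev inequality: `‖f‖_∞² ≤ C A h`, where `A` bounds the second order Sobolev
norm and `h` the part of it involving a horizontal derivative. -/
lemma IsSchwartz.sq_le_mul {f : Pt → ℝ} (hf : IsSchwartz f) {A h : ℝ}
    (hA0 : l2n f ≤ A) (hA1 : ∀ i, l2n (_root_.pd i f) ≤ A)
    (hA2 : ∀ i j, l2n (_root_.pd j (_root_.pd i f)) ≤ A)
    (hh1 : ∀ i, i ≠ 2 → l2n (_root_.pd i f) ≤ h)
    (hh2 : ∀ i j, (i ≠ 2 ∨ j ≠ 2) → l2n (_root_.pd j (_root_.pd i f)) ≤ h) (x : Pt) :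
    f x ^ 2 ≤ 10816 * (A * h) := by
  have hA : 0 ≤ A := (l2n_nonneg f).trans hA0
  have hh : 0 ≤ h := (l2n_nonneg _).trans (hh1 0 (by decide))
  set k := min A h with hk
  have hk0 : 0 ≤ k := le_min hA hh
  have hk1 : ∀ i, i ≠ 2 → l2n (_root_.pd i f) ≤ k := fun i hi => le_min (hA1 i) (hh1 i hi)
  have hk2 : ∀ i j, (i ≠ 2 ∨ j ≠ 2) → l2n (_root_.pd j (_root_.pd i f)) ≤ k :=
    fun i j hij => le_min (hA2 i j) (hh2 i j hij)
  have key : ∀ l : ℝ, 0 < l → |f x| ≤ 8 * (3 * A / l + 6 * k + 4 * l * k) := by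
    intro l hl
    have hd : ∀ i, 0 < (![l, l, 1] : Pt) i := by
      intro i
      fin_cases i <;> simp [hl]
    have hs := abs_le_of_scaling hf x hd
    have hsq : Real.sqrt ((∏ i, (![l, l, 1] : Pt) i)⁻¹) = l⁻¹ := by
      rw [Fin.prod_univ_three]
      simp only [Matrix.cons_val_zero, Matrix.cons_val_one, Matrix.cons_val, mul_one]
      rw [Real.sqrt_inv, Real.sqrt_mul_self hl.le]
    rw [hsq] at hs
    simp only [Fin.sum_univ_three, Matrix.cons_val_zero, Matrix.cons_val_one,
      Matrix.cons_val, mul_one, one_mul] at hs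
    refine hs.trans ?_
    have e : 8 * (3 * A / l + 6 * k + 4 * l * k) = 8 * l⁻¹ *
        (A + (l * k + l * k + A) + ((l * l * k + l * l * k + l * k)
          + (l * l * k + l * l * k + l * k) + (l * k + l * k + A))) := by
      field_simp
      ring
    rw [e]
    gcongr
    all_goals first
      | exact hk1 _ (by decide)
      | exact hk2 _ _ (by decide)
      | exact hA1 _
      | exact hA2 _ _
  rcases hk0.eq_or_lt with h0 | hpos
  · have : f x = 0 := by
      by_contra hne
      have hf0 : 0 < |f x| := abs_pos.2 hne
      have := key ((24 * A + 1) / |f x|) (by positivity)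
      rw [← h0] at this
      have e : 8 * (3 * A / ((24 * A + 1) / |f x|) + 6 * 0 + 4 * ((24 * A + 1) / |f x|) * 0)
          = 24 * A * |f x| / (24 * A + 1) := by
        field_simp
        ring
      rw [e, le_div_iff₀ (by positivity)] at this
      nlinarith
    rw [this]
    linarith [mul_nonneg hA hh]
  · have hApos : 0 < A := hpos.trans_le (min_le_left _ _)
    have hsA := Real.sqrt_pos.2 hApos
    have hsk := Real.sqrt_pos.2 hpos
    have h1 := key (Real.sqrt A / Real.sqrt k) (by positivity)
    have eA : A = Real.sqrt A ^ 2 := (Real.sq_sqrt hA).symm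
    have ek : k = Real.sqrt k ^ 2 := (Real.sq_sqrt hk0).symm
    have hle : Real.sqrt k ≤ Real.sqrt A := Real.sqrt_le_sqrt (min_le_left _ _)
    set s := Real.sqrt A
    set q := Real.sqrt k
    have e : 8 * (3 * A / (s / q) + 6 * k + 4 * (s / q) * k)
        = 8 * (3 * s * q + 6 * q ^ 2 + 4 * s * q) := by
      rw [ek, eA]
      field_simp
    rw [e] at h1
    have h2 : |f x| ≤ 104 * (s * q) := by nlinarith
    have h3 : f x ^ 2 ≤ (104 * (s * q)) ^ 2 := by
      rw [← sq_abs]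
      gcongr
    have h4 : (104 * (s * q)) ^ 2 = 10816 * (A * k) := by
      rw [ek, eA]
      ring
    rw [h4] at h3
    refine h3.trans ?_
    gcongr
    exact min_le_right _ _

lemma IsSchwartz.abs_le_of_l2n {f : Pt → ℝ} (hf : IsSchwartz f) {A : ℝ}
    (hA0 : l2n f ≤ A) (hA1 : ∀ i, l2n (_root_.pd i f) ≤ A)
    (hA2 : ∀ i j, l2n (_root_.pd j (_root_.pd i f)) ≤ A) (x : Pt) :
    |f x| ≤ 104 * A := by
  have hA : 0 ≤ A := (l2n_nonneg f).trans hA0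
  refine abs_le_of_sq_le_sq ?_ (by positivity)
  have := hf.sq_le_mul hA0 hA1 hA2 (fun i _ => hA1 i) (fun i j _ => hA2 i j) x
  linarith

lemma l2Sq_pdM_le_hSq {k : ℕ} {α : Fin 3 → ℕ} (hα : α ∈ midx k) (f : Pt → ℝ) :
    l2Sq (pdM α f) ≤ hSq k f := by
  have h := Finset.single_le_sum (f := fun α => ∫ x : Pt, pdM α f x * pdM α f x)
    (fun α _ => integral_nonneg fun x => mul_self_nonneg _) hα
  simpa only [l2Sq, hSq, hInner, pow_two] using h

lemma hSq_nonneg (k : ℕ) (f : Pt → ℝ) : 0 ≤ hSq k f :=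
  Finset.sum_nonneg fun _ _ => integral_nonneg fun _ => mul_self_nonneg _

lemma gradHSq_nonneg (k : ℕ) (f : Pt → ℝ) : 0 ≤ gradHSq k f :=
  Finset.sum_nonneg fun _ _ => hSq_nonneg _ _

lemma gradHHSq_nonneg (k : ℕ) (f : Pt → ℝ) : 0 ≤ gradHHSq k f :=
  Finset.sum_nonneg fun _ _ => Finset.sum_nonneg fun _ _ => hSq_nonneg _ _

lemma gradVecHSq_nonneg (k : ℕ) (u : Fin 3 → Pt → ℝ) : 0 ≤ gradVecHSq k u :=
  Finset.sum_nonneg fun _ _ => gradHSq_nonneg _ _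

lemma l2Sq_le_hSq (k : ℕ) (f : Pt → ℝ) : l2Sq f ≤ hSq k f :=
  l2Sq_pdM_le_hSq (α := 0) (by simp [midx]) f

lemma l2Sq_pd_le_hSq {k : ℕ} (hk : 1 ≤ k) (f : Pt → ℝ) (i : Fin 3) : l2Sq (pd i f) ≤ hSq k f := by
  have e : pdM (Pi.single i 1) f = pd i f := by
    fin_cases i <;> simp [pdM]
  rw [← e]
  refine l2Sq_pdM_le_hSq ?_ f
  simp only [midx, Finset.mem_filter, Fintype.mem_piFinset, Finset.mem_range]
  refine ⟨fun j => ?_, by simpa using hk⟩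
  rw [Pi.single_apply]
  split_ifs <;> omega

lemma l2Sq_pd_pd_le_hSq {f : Pt → ℝ} (hf : ContDiff ℝ (⊤ : ℕ∞) f) (i j : Fin 3) :
    l2Sq (pd i (pd j f)) ≤ hSq 2 f := by
  wlog hij : i ≤ j generalizing i j
  · rw [pd_comm hf]
    exact this j i (le_of_not_ge hij)
  have e : pdM (Pi.single i 1 + Pi.single j 1) f = pd i (pd j f) := by
    fin_cases i <;> fin_cases j <;> simp [pdM] at hij ⊢
  have hm : ∀ i j : Fin 3, (Pi.single i 1 + Pi.single j 1 : Fin 3 → ℕ) ∈ midx 2 := by decide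
  rw [← e]
  exact l2Sq_pdM_le_hSq (hm i j) f

section FixedTime

variable {a : Pt → ℝ} {u : Fin 3 → Pt → ℝ}

lemma hSq_le_gradHSq (k : ℕ) (a : Pt → ℝ) (i : Fin 3) : hSq k (pd i a) ≤ gradHSq k a :=
  Finset.single_le_sum (f := fun i => hSq k (pd i a)) (fun _ _ => hSq_nonneg _ _)
    (Finset.mem_univ i)

lemma hSq_le_gradHHSq (k : ℕ) (a : Pt → ℝ) {i : Fin 3} (hi : i ≠ 2) (j : Fin 3) :
    hSq k (pd i (pd j a)) ≤ gradHHSq k a := by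
  have hi' : i ∈ hIdx := by
    revert i
    decide
  refine (Finset.single_le_sum (f := fun j => hSq k (pd i (pd j a)))
    (fun _ _ => hSq_nonneg _ _) (Finset.mem_univ j)).trans ?_
  exact Finset.single_le_sum (f := fun i => ∑ j, hSq k (pd i (pd j a)))
    (fun _ _ => Finset.sum_nonneg fun _ _ => hSq_nonneg _ _) hi'

lemma hSq_le_gradVecHSq (k : ℕ) (u : Fin 3 → Pt → ℝ) (i j : Fin 3) :
    hSq k (pd i (u j)) ≤ gradVecHSq k u :=
  (hSq_le_gradHSq k (u j) i).trans (Finset.single_le_sum (f := fun j => gradHSq k (u j))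
    (fun _ _ => gradHSq_nonneg _ _) (Finset.mem_univ j))

lemma hSq_le_vecHSq (k : ℕ) (u : Fin 3 → Pt → ℝ) (j : Fin 3) :
    hSq k (u j) ≤ vecHSq k u :=
  Finset.single_le_sum (f := fun j => hSq k (u j)) (fun _ _ => hSq_nonneg _ _)
    (Finset.mem_univ j)

/-- The Sobolev embedding `H² ⊂ L^∞`. -/
lemma IsSchwartz.abs_le_sqrt_hSq {f : Pt → ℝ} (hf : IsSchwartz f) (x : Pt) :
    |f x| ≤ 104 * Real.sqrt (hSq 2 f) :=
  hf.abs_le_of_l2n (Real.sqrt_le_sqrt (l2Sq_le_hSq 2 f))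
    (fun i => Real.sqrt_le_sqrt (l2Sq_pd_le_hSq one_le_two f i))
    (fun i j => Real.sqrt_le_sqrt (l2Sq_pd_pd_le_hSq hf.1 j i)) x

lemma abs_le_vecHSq (hu : ∀ j, IsSchwartz (u j)) (j : Fin 3) (x : Pt) :
    |u j x| ≤ 104 * Real.sqrt (vecHSq 2 u) :=
  ((hu j).abs_le_sqrt_hSq x).trans
    (mul_le_mul_of_nonneg_left (Real.sqrt_le_sqrt (hSq_le_vecHSq 2 u j)) (by norm_num))

lemma abs_pd_le_gradVecHSq (hu : ∀ j, IsSchwartz (u j)) (i j : Fin 3) (x : Pt) :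
    |pd i (u j) x| ≤ 104 * Real.sqrt (gradVecHSq 2 u) :=
  (((hu j).pd i).abs_le_sqrt_hSq x).trans
    (mul_le_mul_of_nonneg_left (Real.sqrt_le_sqrt (hSq_le_gradVecHSq 2 u i j)) (by norm_num))

lemma abs_pd_le_gradHSq (ha : IsSchwartz a) (i : Fin 3) (x : Pt) :
    |pd i a x| ≤ 104 * Real.sqrt (gradHSq 2 a) :=
  ((ha.pd i).abs_le_sqrt_hSq x).trans
    (mul_le_mul_of_nonneg_left (Real.sqrt_le_sqrt (hSq_le_gradHSq 2 a i)) (by norm_num))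

lemma sq_pd_le (ha : IsSchwartz a) (i : Fin 3) (x : Pt) :
    pd i a x ^ 2 ≤ 10816 * (Real.sqrt (gradHSq 2 a) * Real.sqrt (gradHHSq 1 a)) := by
  have hs := hSq_le_gradHSq 2 a i
  refine (ha.pd i).sq_le_mul (Real.sqrt_le_sqrt ((l2Sq_le_hSq 2 _).trans hs))
    (fun j => Real.sqrt_le_sqrt ((l2Sq_pd_le_hSq one_le_two _ j).trans hs))
    (fun j k => Real.sqrt_le_sqrt ((l2Sq_pd_pd_le_hSq (ha.pd i).1 k j).trans hs))
    (fun j hj => Real.sqrt_le_sqrt ((l2Sq_le_hSq 1 _).trans (hSq_le_gradHHSq 1 a hj i)))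
    (fun j k hjk => Real.sqrt_le_sqrt ?_) x
  rcases hjk with hj | hk
  · exact (l2Sq_pd_le_hSq le_rfl _ k).trans (hSq_le_gradHHSq 1 a hj i)
  · rw [pd_comm (ha.pd i).1]
    exact (l2Sq_pd_le_hSq le_rfl _ j).trans (hSq_le_gradHHSq 1 a hk i)

lemma abs_pd_mul_pd_le (ha : IsSchwartz a) (i j : Fin 3) (x : Pt) :
    |pd i a x * pd j a x| ≤ 10816 * (Real.sqrt (gradHSq 2 a) * Real.sqrt (gradHHSq 1 a)) := by
  have h1 := sq_pd_le ha i x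
  have h2 := sq_pd_le ha j x
  rw [abs_le]
  constructor <;> nlinarith [sq_nonneg (pd i a x + pd j a x), sq_nonneg (pd i a x - pd j a x)]

lemma l2n_pd_pd_pd_le (ha : IsSchwartz a) (i j k : Fin 3) :
    l2n (pd i (pd j (pd k a))) ≤ Real.sqrt (gradHSq 2 a) :=
  Real.sqrt_le_sqrt ((l2Sq_pd_pd_le_hSq (ha.pd k).1 i j).trans (hSq_le_gradHSq 2 a k))

lemma l2n_pd_pd_pd_vec_le (hu : ∀ j, IsSchwartz (u j)) (i j k l : Fin 3) :
    l2n (pd i (pd j (pd k (u l)))) ≤ Real.sqrt (gradVecHSq 2 u) :=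
  Real.sqrt_le_sqrt ((l2Sq_pd_pd_le_hSq ((hu l).pd k).1 i j).trans (hSq_le_gradVecHSq 2 u k l))

lemma integral_pow_four_le {f : Pt → ℝ} (hf : IsSchwartz f) (i : Fin 3) {K : ℝ}
    (h0 : ∀ x, |f x| ≤ 104 * K) (h2 : l2n (pd i (pd i f)) ≤ K) :
    ∫ x, (pd i f x ^ 2) ^ 2 ≤ (312 * K ^ 2) ^ 2 := by
  refine (hf.integral_pd_pow_four_le i h0).trans ?_
  rw [← l2n_sq]
  have : l2n (pd i (pd i f)) ^ 2 ≤ K ^ 2 := pow_le_pow_left₀ (l2n_nonneg _) h2 2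
  calc _ ≤ 9 * (104 * K) ^ 2 * K ^ 2 := by gcongr
    _ = _ := by ring

lemma l2n_pd_pd_mul_le (ha : IsSchwartz a) (hu : ∀ j, IsSchwartz (u j)) (i j : Fin 3) :
    l2n (fun x => pd 2 (pd 2 (u j)) x * pd 2 (pd i a) x)
      ≤ 312 * (Real.sqrt (gradVecHSq 2 u) * Real.sqrt (gradHSq 2 a)) := by
  have hW := Real.sqrt_nonneg (gradVecHSq 2 u)
  have hA := Real.sqrt_nonneg (gradHSq 2 a)
  have hp := ((hu j).pd 2).pd 2
  have hq := (ha.pd i).pd 2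
  have h1 := integral_pow_four_le ((hu j).pd 2) 2 (abs_pd_le_gradVecHSq hu 2 j)
    (l2n_pd_pd_pd_vec_le hu 2 2 2 j)
  have h2 := integral_pow_four_le (ha.pd 2) i (abs_pd_le_gradHSq ha 2)
    (l2n_pd_pd_pd_le ha i i 2)
  rw [pd_comm ha.1] at h2
  set W := Real.sqrt (gradVecHSq 2 u)
  set A := Real.sqrt (gradHSq 2 a)
  have h := hp.sq.integral_abs_mul_le hq.sq
  have h1' : l2n (fun x => pd 2 (pd 2 (u j)) x ^ 2) ≤ 312 * W ^ 2 :=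
    (Real.sqrt_le_sqrt h1).trans (Real.sqrt_sq (by positivity)).le
  have h2' : l2n (fun x => pd 2 (pd i a) x ^ 2) ≤ 312 * A ^ 2 :=
    (Real.sqrt_le_sqrt h2).trans (Real.sqrt_sq (by positivity)).le
  refine Real.sqrt_le_iff.2 ⟨by positivity, ?_⟩
  have e : l2Sq (fun x => pd 2 (pd 2 (u j)) x * pd 2 (pd i a) x)
      = ∫ x, |pd 2 (pd 2 (u j)) x ^ 2 * pd 2 (pd i a) x ^ 2| := by
    simp only [l2Sq]
    congr 1
    funext x
    rw [abs_of_nonneg (by positivity)]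
    ring
  rw [e]
  calc _ ≤ _ := h
    _ ≤ (312 * W ^ 2) * (312 * A ^ 2) :=
      mul_le_mul h1' h2' (l2n_nonneg _) (by positivity)
    _ = _ := by ring

/-- The terms left after using the transport equation. -/
def remainder (a : Pt → ℝ) (u : Fin 3 → Pt → ℝ) (x : Pt) : ℝ :=
  (∑ i, pd 2 a x * pd 2 (u i) x * pd i a x * pd 2 (pd 2 (pd 2 a)) x ^ 2)
  + pd 2 a x ^ 2 * pd 2 (pd 2 (pd 2 a)) x *
    (pd 2 (pd 2 (pd 2 (u 2))) x + ∑ i, (pd 2 (pd 2 (pd 2 (u i))) x * pd i a x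
      + 3 * (pd 2 (pd 2 (u i)) x * pd 2 (pd i a) x)
      + 3 * (pd 2 (u i) x * pd 2 (pd 2 (pd i a)) x)))

lemma isSchwartz_remainder (ha : IsSchwartz a) (hu : ∀ j, IsSchwartz (u j)) :
    IsSchwartz (remainder a u) := by
  have h3 := ((ha.pd 2).pd 2).pd 2
  refine (IsSchwartz.sum _ fun i _ =>
    (((ha.pd 2).mul ((hu i).pd 2)).mul (ha.pd i)).mul h3.sq).add
    (((ha.pd 2).sq.mul h3).mul (((((hu 2).pd 2).pd 2).pd 2).add (IsSchwartz.sum _ fun i _ => ?_)))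
  exact ((((((hu i).pd 2).pd 2).pd 2).mul (ha.pd i)).add
    (((((hu i).pd 2).pd 2).mul ((ha.pd i).pd 2)).const_mul 3)).add
    ((((hu i).pd 2).mul (((ha.pd i).pd 2).pd 2)).const_mul 3)

set_option maxHeartbeats 1000000 in
lemma integral_abs_remainder_le (ha : IsSchwartz a) (hu : ∀ j, IsSchwartz (u j)) :
    ∫ x, |remainder a u x| ≤ 10 ^ 8 * (Real.sqrt (gradHSq 2 a) ^ 2 * (1 + Real.sqrt (gradHSq 2 a))
      * (Real.sqrt (gradHHSq 1 a) * Real.sqrt (gradVecHSq 2 u))) := by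
  have hW := Real.sqrt_nonneg (gradVecHSq 2 u)
  have hA := Real.sqrt_nonneg (gradHSq 2 a)
  have hh := Real.sqrt_nonneg (gradHHSq 1 a)
  have b1 := fun i j => abs_pd_mul_pd_le ha i j
  have b2 := fun j => abs_pd_le_gradVecHSq hu 2 j
  have b3 := fun i => abs_pd_le_gradHSq ha i
  have n1 := l2n_pd_pd_pd_le ha
  have n2 := l2n_pd_pd_pd_vec_le hu 2 2 2
  have n3 := l2n_pd_pd_mul_le ha hu
  set W := Real.sqrt (gradVecHSq 2 u)
  set A := Real.sqrt (gradHSq 2 a)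
  set h := Real.sqrt (gradHHSq 1 a)
  have s0 := ((ha.pd 2).pd 2).pd 2
  have s1 := fun i => (((hu i).pd 2).pd 2).pd 2
  have s2 := fun i => (((hu i).pd 2).pd 2).mul ((ha.pd i).pd 2)
  have s3 := fun i => ((ha.pd i).pd 2).pd 2
  set g := pd 2 (pd 2 (pd 2 a)) with hg
  have hpt : ∀ x, |remainder a u x| ≤ (10816 * (A * h)) * ((312 * W) * g x ^ 2
      + (|g x * pd 2 (pd 2 (pd 2 (u 2))) x| + ∑ i, ((104 * A) * |g x * pd 2 (pd 2 (pd 2 (u i))) x|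
      + 3 * |g x * (pd 2 (pd 2 (u i)) x * pd 2 (pd i a) x)|
      + (312 * W) * |g x * pd 2 (pd 2 (pd i a)) x|))) := by
    intro x
    have t1 : |∑ i, pd 2 a x * pd 2 (u i) x * pd i a x * g x ^ 2|
        ≤ ∑ _i : Fin 3, (10816 * (A * h)) * ((104 * W) * g x ^ 2) := by
      refine (Finset.abs_sum_le_sum_abs _ _).trans (Finset.sum_le_sum fun i _ => ?_)
      have e : pd 2 a x * pd 2 (u i) x * pd i a x * g x ^ 2
          = (pd 2 a x * pd i a x) * (pd 2 (u i) x * g x ^ 2) := by ring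
      rw [e, abs_mul, abs_mul (pd 2 (u i) x), abs_of_nonneg (sq_nonneg (g x))]
      have := b1 2 i x
      have := b2 i x
      gcongr
    have t2 : |pd 2 a x ^ 2 * g x *
        (pd 2 (pd 2 (pd 2 (u 2))) x + ∑ i, (pd 2 (pd 2 (pd 2 (u i))) x * pd i a x
          + 3 * (pd 2 (pd 2 (u i)) x * pd 2 (pd i a) x)
          + 3 * (pd 2 (u i) x * pd 2 (pd 2 (pd i a)) x)))|
        ≤ (10816 * (A * h)) * (|g x * pd 2 (pd 2 (pd 2 (u 2))) x|
          + ∑ i, ((104 * A) * |g x * pd 2 (pd 2 (pd 2 (u i))) x|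
          + 3 * |g x * (pd 2 (pd 2 (u i)) x * pd 2 (pd i a) x)|
          + (312 * W) * |g x * pd 2 (pd 2 (pd i a)) x|)) := by
      rw [mul_assoc, abs_mul, pow_two, mul_add, Finset.mul_sum]
      refine mul_le_mul (b1 2 2 x) ?_ (abs_nonneg _) (by positivity)
      refine (abs_add_le _ _).trans (add_le_add le_rfl ((Finset.abs_sum_le_sum_abs _ _).trans
        (Finset.sum_le_sum fun i _ => ?_)))
      have e : g x * (pd 2 (pd 2 (pd 2 (u i))) x * pd i a x
          + 3 * (pd 2 (pd 2 (u i)) x * pd 2 (pd i a) x)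
          + 3 * (pd 2 (u i) x * pd 2 (pd 2 (pd i a)) x))
          = pd i a x * (g x * pd 2 (pd 2 (pd 2 (u i))) x)
          + 3 * (g x * (pd 2 (pd 2 (u i)) x * pd 2 (pd i a) x))
          + (3 * pd 2 (u i) x) * (g x * pd 2 (pd 2 (pd i a)) x) := by ring
      rw [e]
      refine (abs_add_le _ _).trans (add_le_add ((abs_add_le _ _).trans (add_le_add ?_ ?_)) ?_)
      · rw [abs_mul]
        exact mul_le_mul_of_nonneg_right (b3 i x) (abs_nonneg _)
      · rw [abs_mul, abs_of_nonneg (by norm_num : (0 : ℝ) ≤ 3)]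
      · rw [abs_mul, abs_mul, abs_of_nonneg (by norm_num : (0 : ℝ) ≤ 3)]
        refine mul_le_mul_of_nonneg_right ?_ (abs_nonneg _)
        linarith [b2 i x]
    refine (abs_add_le _ _).trans ((add_le_add t1 t2).trans (le_of_eq ?_))
    simp only [Finset.sum_const, Finset.card_univ, Fintype.card_fin, nsmul_eq_mul]
    push_cast
    ring
  have i0 : Integrable fun x => g x ^ 2 := s0.sq.integrable
  have i1 := fun i => (s0.mul (s1 i)).integrable.abs
  have i2 := fun i => (s0.mul (s2 i)).integrable.abs
  have i3 := fun i => (s0.mul (s3 i)).integrable.abs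
  have i7 : ∀ i, Integrable fun x => (104 * A) * |g x * pd 2 (pd 2 (pd 2 (u i))) x|
      + 3 * |g x * (pd 2 (pd 2 (u i)) x * pd 2 (pd i a) x)| :=
    fun i => ((i1 i).const_mul (104 * A)).add ((i2 i).const_mul 3)
  have i4 : ∀ i, Integrable fun x => (104 * A) * |g x * pd 2 (pd 2 (pd 2 (u i))) x|
      + 3 * |g x * (pd 2 (pd 2 (u i)) x * pd 2 (pd i a) x)|
      + (312 * W) * |g x * pd 2 (pd 2 (pd i a)) x| :=
    fun i => (i7 i).add ((i3 i).const_mul (312 * W))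
  have i5 : Integrable fun x => ∑ i, ((104 * A) * |g x * pd 2 (pd 2 (pd 2 (u i))) x|
      + 3 * |g x * (pd 2 (pd 2 (u i)) x * pd 2 (pd i a) x)|
      + (312 * W) * |g x * pd 2 (pd 2 (pd i a)) x|) :=
    integrable_finsetSum Finset.univ fun i _ => i4 i
  have i6 : Integrable fun x => |g x * pd 2 (pd 2 (pd 2 (u 2))) x|
      + ∑ i, ((104 * A) * |g x * pd 2 (pd 2 (pd 2 (u i))) x|
      + 3 * |g x * (pd 2 (pd 2 (u i)) x * pd 2 (pd i a) x)|
      + (312 * W) * |g x * pd 2 (pd 2 (pd i a)) x|) := (i1 2).add i5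
  have hmono := integral_mono (isSchwartz_remainder ha hu).integrable.abs
    (((i0.const_mul (312 * W)).add i6).const_mul (10816 * (A * h))) hpt
  refine hmono.trans ?_
  simp only [Pi.add_apply]
  rw [integral_const_mul, integral_add (i0.const_mul _) i6, integral_const_mul,
    integral_add (i1 2) i5, integral_finsetSum _ fun i _ => i4 i]
  have j0 : ∫ x, g x ^ 2 ≤ A ^ 2 := by
    have := pow_le_pow_left₀ (l2n_nonneg _) (n1 2 2 2) 2
    rwa [l2n_sq] at this
  have hgA : l2n g ≤ A := n1 2 2 2
  have j1 : ∀ i, ∫ x, |g x * pd 2 (pd 2 (pd 2 (u i))) x| ≤ A * W := fun i =>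
    (s0.integral_abs_mul_le (s1 i)).trans (mul_le_mul hgA (n2 i) (l2n_nonneg _) hA)
  have j2 : ∀ i, ∫ x, |g x * (pd 2 (pd 2 (u i)) x * pd 2 (pd i a) x)| ≤ A * (312 * (W * A)) :=
    fun i => (s0.integral_abs_mul_le (s2 i)).trans (mul_le_mul hgA (n3 i i) (l2n_nonneg _) hA)
  have j3 : ∀ i, ∫ x, |g x * pd 2 (pd 2 (pd i a)) x| ≤ A * A := fun i =>
    (s0.integral_abs_mul_le (s3 i)).trans (mul_le_mul hgA (n1 2 2 i) (l2n_nonneg _) hA)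
  have j4 : ∀ i, ∫ x, ((104 * A) * |g x * pd 2 (pd 2 (pd 2 (u i))) x|
      + 3 * |g x * (pd 2 (pd 2 (u i)) x * pd 2 (pd i a) x)|
      + (312 * W) * |g x * pd 2 (pd 2 (pd i a)) x|)
      ≤ (104 * A) * (A * W) + 3 * (A * (312 * (W * A))) + (312 * W) * (A * A) := by
    intro i
    rw [integral_add (i7 i) ((i3 i).const_mul _),
      integral_add ((i1 i).const_mul _) ((i2 i).const_mul _), integral_const_mul,
      integral_const_mul, integral_const_mul]
    have := j1 i
    have := j2 i
    have := j3 i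
    gcongr
  calc _ ≤ (10816 * (A * h)) * ((312 * W) * A ^ 2 + (A * W + ∑ _i : Fin 3,
        ((104 * A) * (A * W) + 3 * (A * (312 * (W * A))) + (312 * W) * (A * A)))) := by
        have := j1 2
        gcongr with i
        exact j4 i
    _ = 10816 * (A ^ 2 * (1 + 4368 * A) * (h * W)) := by
        simp only [Finset.sum_const, Finset.card_univ, Fintype.card_fin, nsmul_eq_mul]
        push_cast
        ring
    _ ≤ 10816 * (A ^ 2 * (4368 * (1 + A)) * (h * W)) := by
        gcongr
        linarith
    _ ≤ _ := by
        have : 0 ≤ A ^ 2 * (1 + A) * (h * W) := by positivity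
        nlinarith

end FixedTime

section Energy

variable {a : Pt → ℝ} {u : Fin 3 → Pt → ℝ}

/-- The energy density `½ (∂₃a)² (∂₃³a)²`. -/
def density (a : Pt → ℝ) (x : Pt) : ℝ :=
  1 / 2 * (pd 2 a x ^ 2 * pd 2 (pd 2 (pd 2 a)) x ^ 2)

/-- The derivative of `density` at `a` in direction `b`. -/
def densityRate (a b : Pt → ℝ) (x : Pt) : ℝ :=
  pd 2 a x * pd 2 b x * pd 2 (pd 2 (pd 2 a)) x ^ 2
    + pd 2 a x ^ 2 * pd 2 (pd 2 (pd 2 a)) x * pd 2 (pd 2 (pd 2 b)) x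

/-- The transport term `u·∇a + u₃`. -/
def transport (a : Pt → ℝ) (u : Fin 3 → Pt → ℝ) (x : Pt) : ℝ :=
  (∑ i, u i x * pd i a x) + u 2 x

/-- The integrand `∂₃a ∂₃u₃ (∂₃³a)²`. -/
def target (a : Pt → ℝ) (u : Fin 3 → Pt → ℝ) (x : Pt) : ℝ :=
  pd 2 a x * pd 2 (u 2) x * pd 2 (pd 2 (pd 2 a)) x ^ 2

lemma isSchwartz_density (ha : IsSchwartz a) : IsSchwartz (density a) :=
  ((ha.pd 2).sq.mul (((ha.pd 2).pd 2).pd 2).sq).const_mul _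

lemma isSchwartz_transport (ha : IsSchwartz a) (hu : ∀ j, IsSchwartz (u j)) :
    IsSchwartz (transport a u) :=
  (IsSchwartz.sum _ fun i _ => (hu i).mul (ha.pd i)).add (hu 2)

lemma isSchwartz_densityRate {b : Pt → ℝ} (ha : IsSchwartz a) (hb : IsSchwartz b) :
    IsSchwartz (densityRate a b) :=
  (((ha.pd 2).mul (hb.pd 2)).mul (((ha.pd 2).pd 2).pd 2).sq).add
    (((ha.pd 2).sq.mul (((ha.pd 2).pd 2).pd 2)).mul (((hb.pd 2).pd 2).pd 2))

lemma isSchwartz_target (ha : IsSchwartz a) (hu : ∀ j, IsSchwartz (u j)) :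
    IsSchwartz (target a u) :=
  ((ha.pd 2).mul ((hu 2).pd 2)).mul (((ha.pd 2).pd 2).pd 2).sq

lemma pd_density (ha : IsSchwartz a) (i : Fin 3) (x : Pt) :
    pd i (density a) x = pd 2 a x * pd 2 (pd i a) x * pd 2 (pd 2 (pd 2 a)) x ^ 2
      + pd 2 a x ^ 2 * pd 2 (pd 2 (pd 2 a)) x * pd 2 (pd 2 (pd 2 (pd i a))) x := by
  have h1 := (ha.pd 2).differentiable
  have h3 := (((ha.pd 2).pd 2).pd 2).differentiable
  have e : density a = fun x => 1 / 2 * ((pd 2 a x * pd 2 a x) *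
      (pd 2 (pd 2 (pd 2 a)) x * pd 2 (pd 2 (pd 2 a)) x)) := by
    funext x
    simp only [density]
    ring
  have c : pd i (pd 2 (pd 2 (pd 2 a))) = pd 2 (pd 2 (pd 2 (pd i a))) := by
    rw [pd_comm ((ha.pd 2).pd 2).1 i 2, pd_comm (ha.pd 2).1 i 2, pd_comm ha.1 i 2]
  rw [e, pd_const_mul ((h1.fun_mul h1).fun_mul (h3.fun_mul h3)), pd_mul (h1.fun_mul h1) (h3.fun_mul h3),
    pd_mul h1 h1, pd_mul h3 h3, c, pd_comm ha.1 i 2]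
  ring

lemma pd_transport (ha : IsSchwartz a) (hu : ∀ j, IsSchwartz (u j)) :
    pd 2 (transport a u) = fun x =>
      (∑ i, (pd 2 (u i) x * pd i a x + u i x * pd 2 (pd i a) x)) + pd 2 (u 2) x := by
  have h : ∀ i ∈ Finset.univ, Differentiable ℝ fun x => u i x * pd i a x :=
    fun i _ => ((hu i).mul (ha.pd i)).differentiable
  have e : transport a u = fun x => (∑ i, u i x * pd i a x) + u 2 x := rfl
  rw [e, pd_add (IsSchwartz.sum _ fun i _ => (hu i).mul (ha.pd i)).differentiable
    (hu 2).differentiable, pd_sum _ h]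
  simp only [pd_mul (hu _).differentiable (ha.pd _).differentiable]

lemma pd_pd_pd_transport (ha : IsSchwartz a) (hu : ∀ j, IsSchwartz (u j)) :
    pd 2 (pd 2 (pd 2 (transport a u))) = fun x =>
      (∑ i, ((pd 2 (pd 2 (pd 2 (u i))) x * pd i a x
      + 3 * (pd 2 (pd 2 (u i)) x * pd 2 (pd i a) x)
      + 3 * (pd 2 (u i) x * pd 2 (pd 2 (pd i a)) x))
      + u i x * pd 2 (pd 2 (pd 2 (pd i a))) x)) + pd 2 (pd 2 (pd 2 (u 2))) x := by
  have m1 : ∀ i, IsSchwartz fun x => pd 2 (u i) x * pd i a x + u i x * pd 2 (pd i a) x :=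
    fun i => (((hu i).pd 2).mul (ha.pd i)).add ((hu i).mul ((ha.pd i).pd 2))
  have m2 : ∀ i, IsSchwartz fun x => (pd 2 (pd 2 (u i)) x * pd i a x
      + pd 2 (u i) x * pd 2 (pd i a) x) + (pd 2 (u i) x * pd 2 (pd i a) x
      + u i x * pd 2 (pd 2 (pd i a)) x) :=
    fun i => ((((hu i).pd 2).pd 2).mul (ha.pd i)).add (((hu i).pd 2).mul ((ha.pd i).pd 2)) |>.add
      ((((hu i).pd 2).mul ((ha.pd i).pd 2)).add ((hu i).mul (((ha.pd i).pd 2).pd 2)))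
  have e1 : ∀ i, pd 2 (fun x => pd 2 (u i) x * pd i a x + u i x * pd 2 (pd i a) x) = fun x =>
      (pd 2 (pd 2 (u i)) x * pd i a x + pd 2 (u i) x * pd 2 (pd i a) x)
      + (pd 2 (u i) x * pd 2 (pd i a) x + u i x * pd 2 (pd 2 (pd i a)) x) := by
    intro i
    rw [pd_add (((hu i).pd 2).mul (ha.pd i)).differentiable
        ((hu i).mul ((ha.pd i).pd 2)).differentiable,
      pd_mul ((hu i).pd 2).differentiable (ha.pd i).differentiable,
      pd_mul (hu i).differentiable ((ha.pd i).pd 2).differentiable]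
  have e2 : ∀ i, pd 2 (fun x => (pd 2 (pd 2 (u i)) x * pd i a x
      + pd 2 (u i) x * pd 2 (pd i a) x) + (pd 2 (u i) x * pd 2 (pd i a) x
      + u i x * pd 2 (pd 2 (pd i a)) x)) = fun x => (pd 2 (pd 2 (pd 2 (u i))) x * pd i a x
      + 3 * (pd 2 (pd 2 (u i)) x * pd 2 (pd i a) x)
      + 3 * (pd 2 (u i) x * pd 2 (pd 2 (pd i a)) x))
      + u i x * pd 2 (pd 2 (pd 2 (pd i a))) x := by
    intro i
    rw [pd_add
        ((((hu i).pd 2).pd 2).mul (ha.pd i) |>.add (((hu i).pd 2).mul ((ha.pd i).pd 2))).differentiable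
        ((((hu i).pd 2).mul ((ha.pd i).pd 2)).add
          ((hu i).mul (((ha.pd i).pd 2).pd 2))).differentiable,
      pd_add ((((hu i).pd 2).pd 2).mul (ha.pd i)).differentiable
        (((hu i).pd 2).mul ((ha.pd i).pd 2)).differentiable,
      pd_add (((hu i).pd 2).mul ((ha.pd i).pd 2)).differentiable
        ((hu i).mul (((ha.pd i).pd 2).pd 2)).differentiable,
      pd_mul (((hu i).pd 2).pd 2).differentiable (ha.pd i).differentiable,
      pd_mul ((hu i).pd 2).differentiable ((ha.pd i).pd 2).differentiable,
      pd_mul (hu i).differentiable (((ha.pd i).pd 2).pd 2).differentiable]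
    funext x
    ring
  rw [pd_transport ha hu, pd_add (IsSchwartz.sum _ fun i _ => m1 i).differentiable
      ((hu 2).pd 2).differentiable, pd_sum _ fun i _ => (m1 i).differentiable]
  simp only [e1]
  rw [pd_add (IsSchwartz.sum _ fun i _ => m2 i).differentiable
      (((hu 2).pd 2).pd 2).differentiable, pd_sum _ fun i _ => (m2 i).differentiable]
  simp only [e2]

lemma densityRate_transport (ha : IsSchwartz a) (hu : ∀ j, IsSchwartz (u j)) (x : Pt) :
    densityRate a (transport a u) x
      = target a u x + remainder a u x + ∑ i, u i x * pd i (density a) x := by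
  rw [densityRate, pd_pd_pd_transport ha hu, pd_transport ha hu]
  simp only [pd_density ha, target, remainder, Fin.sum_univ_three]
  ring

lemma integral_density_le (ha : IsSchwartz a) :
    ∫ x, density a x ≤ 5408 * Real.sqrt (gradHSq 2 a) ^ 4 := by
  have hA := Real.sqrt_nonneg (gradHSq 2 a)
  have b := abs_pd_le_gradHSq ha 2
  have n := pow_le_pow_left₀ (l2n_nonneg _) (l2n_pd_pd_pd_le ha 2 2 2) 2
  rw [l2n_sq] at n
  set A := Real.sqrt (gradHSq 2 a)
  have h3 := (((ha.pd 2).pd 2).pd 2).sq.integrable.const_mul (5408 * A ^ 2)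
  refine (integral_mono (isSchwartz_density ha).integrable h3 fun x => ?_).trans ?_
  · have : pd 2 a x ^ 2 ≤ (104 * A) ^ 2 := sq_le_sq' (by linarith [abs_le.1 (b x)])
      (abs_le.1 (b x)).2
    have := mul_le_mul_of_nonneg_right this (sq_nonneg (pd 2 (pd 2 (pd 2 a)) x))
    simp only [density]
    linarith
  · rw [integral_const_mul]
    calc _ ≤ 5408 * A ^ 2 * A ^ 2 := by
          have : ∫ x, pd 2 (pd 2 (pd 2 a)) x ^ 2 ≤ A ^ 2 := n
          gcongr
      _ = _ := by ring

lemma density_nonneg (a : Pt → ℝ) (x : Pt) : 0 ≤ density a x := by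
  unfold density
  positivity

lemma integral_abs_target_le (ha : IsSchwartz a) (hu : ∀ j, IsSchwartz (u j)) :
    ∫ x, |target a u x| ≤ 10816 * (Real.sqrt (gradHSq 2 a) ^ 3 * Real.sqrt (gradVecHSq 2 u)) := by
  have hA := Real.sqrt_nonneg (gradHSq 2 a)
  have hW := Real.sqrt_nonneg (gradVecHSq 2 u)
  have b := abs_pd_le_gradHSq ha 2
  have b2 := abs_pd_le_gradVecHSq hu 2 2
  have n := pow_le_pow_left₀ (l2n_nonneg _) (l2n_pd_pd_pd_le ha 2 2 2) 2
  rw [l2n_sq] at n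
  set A := Real.sqrt (gradHSq 2 a)
  set W := Real.sqrt (gradVecHSq 2 u)
  have h3 := (((ha.pd 2).pd 2).pd 2).sq.integrable.const_mul (104 * A * (104 * W))
  refine (integral_mono (isSchwartz_target ha hu).integrable.abs h3 fun x => ?_).trans ?_
  · simp only [target]
    rw [abs_mul, abs_mul, abs_of_nonneg (sq_nonneg (pd 2 (pd 2 (pd 2 a)) x))]
    have := b x
    have := b2 x
    gcongr
  · rw [integral_const_mul]
    calc _ ≤ 104 * A * (104 * W) * A ^ 2 := by
          have : ∫ x, pd 2 (pd 2 (pd 2 a)) x ^ 2 ≤ A ^ 2 := n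
          gcongr
      _ = _ := by ring

/-- Integration by parts of the convective term against a cutoff. -/
lemma abs_integral_convection_le {p χ : Pt → ℝ} {L M : ℝ} (hp : IsSchwartz p) (hp0 : ∀ x, 0 ≤ p x)
    (hχ : IsSchwartz χ) (hu : ∀ j, IsSchwartz (u j)) (hdiv : ∀ x, ∑ i, pd i (u i) x = 0)
    (hL : ∀ i x, |pd i χ x| ≤ L) (hM : ∀ i x, |u i x| ≤ M) :
    |∫ x, χ x * ∑ i, u i x * pd i p x| ≤ 3 * M * L * ∫ x, p x := by
  have hs : ∀ i, IsSchwartz fun x => (χ x * u i x) * p x := fun i => (hχ.mul (hu i)).mul hp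
  have hz : ∫ x, ∑ i, pd i (fun x => (χ x * u i x) * p x) x = 0 := by
    rw [integral_finsetSum _ fun i _ => ((hs i).pd i).integrable]
    exact Finset.sum_eq_zero fun i _ => (hs i).integral_pd i
  have hpt : ∀ x, ∑ i, pd i (fun x => (χ x * u i x) * p x) x
      = χ x * (∑ i, u i x * pd i p x) + (∑ i, pd i χ x * u i x) * p x := by
    intro x
    have e : ∀ i, pd i (fun x => (χ x * u i x) * p x) x
        = χ x * (u i x * pd i p x) + (pd i χ x * u i x) * p x + χ x * p x * pd i (u i) x := by
      intro i
      rw [pd_mul (hχ.mul (hu i)).differentiable hp.differentiable,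
        pd_mul hχ.differentiable (hu i).differentiable]
      ring
    simp only [e, Finset.sum_add_distrib, ← Finset.mul_sum, ← Finset.sum_mul, hdiv, mul_zero,
      add_zero]
  have i1 : Integrable fun x => χ x * ∑ i, u i x * pd i p x :=
    (hχ.mul (IsSchwartz.sum _ fun i _ => (hu i).mul (hp.pd i))).integrable
  have i2 : Integrable fun x => (∑ i, pd i χ x * u i x) * p x :=
    ((IsSchwartz.sum _ fun i _ => (hχ.pd i).mul (hu i)).mul hp).integrable
  simp only [hpt] at hz
  rw [integral_add i1 i2] at hz
  rw [eq_neg_of_add_eq_zero_left hz, abs_neg]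
  refine abs_integral_le_integral_abs.trans ?_
  rw [← integral_const_mul]
  refine integral_mono i2.abs (hp.integrable.const_mul _) fun x => ?_
  simp only
  rw [abs_mul, abs_of_nonneg (hp0 x)]
  refine mul_le_mul_of_nonneg_right ?_ (hp0 x)
  refine (Finset.abs_sum_le_sum_abs _ _).trans ((Finset.sum_le_sum (g := fun _ => L * M)
    fun i _ => ?_).trans (le_of_eq ?_))
  · rw [abs_mul]
    exact mul_le_mul (hL i x) (hM i x) (abs_nonneg _) ((abs_nonneg _).trans (hL i x))
  · simp
    ring

lemma abs_integral_cutoff_target_sub_le {χ : Pt → ℝ} {L : ℝ} (ha : IsSchwartz a)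
    (hu : ∀ j, IsSchwartz (u j)) (hχ : IsSchwartz χ) (hχ1 : ∀ x, |χ x| ≤ 1)
    (hdiv : ∀ x, ∑ i, pd i (u i) x = 0) (hL : ∀ i x, |pd i χ x| ≤ L) :
    |(∫ x, χ x * target a u x) - ∫ x, χ x * densityRate a (transport a u) x| ≤
      10 ^ 8 * (Real.sqrt (gradHSq 2 a) ^ 2 * (1 + Real.sqrt (gradHSq 2 a))
      * (Real.sqrt (gradHHSq 1 a) * Real.sqrt (gradVecHSq 2 u)))
      + 3 * (104 * Real.sqrt (vecHSq 2 u)) * L * (5408 * Real.sqrt (gradHSq 2 a) ^ 4) := by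
  have hr := isSchwartz_remainder ha hu
  have hp := isSchwartz_density ha
  have hc : IsSchwartz fun x => ∑ i, u i x * pd i (density a) x :=
    IsSchwartz.sum _ fun i _ => (hu i).mul (hp.pd i)
  have hL0 : 0 ≤ L := (abs_nonneg _).trans (hL 0 0)
  have e : (∫ x, χ x * target a u x) - ∫ x, χ x * densityRate a (transport a u) x
      = -((∫ x, χ x * remainder a u x) + ∫ x, χ x * ∑ i, u i x * pd i (density a) x) := by
    rw [← integral_add (hχ.mul hr).integrable (hχ.mul hc).integrable, ← integral_neg,
      ← integral_sub (hχ.mul (isSchwartz_target ha hu)).integrable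
      (hχ.mul (isSchwartz_densityRate ha (isSchwartz_transport ha hu))).integrable]
    congr 1
    funext x
    rw [densityRate_transport ha hu]
    ring
  rw [e, abs_neg]
  refine (abs_add_le _ _).trans (add_le_add ?_ ?_)
  · refine abs_integral_le_integral_abs.trans ((integral_mono (hχ.mul hr).integrable.abs
      hr.integrable.abs fun x => ?_).trans (integral_abs_remainder_le ha hu))
    simp only
    rw [abs_mul]
    exact mul_le_of_le_one_left (abs_nonneg _) (hχ1 x)
  · refine (abs_integral_convection_le hp (density_nonneg a) hχ hu hdiv hL
      (fun i x => abs_le_vecHSq hu i x)).trans ?_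
    exact mul_le_mul_of_nonneg_left (integral_density_le ha) (by positivity)

end Energy

/-- Smooth cutoffs with values in `[0,1]`, equal to `1` near any given point eventually, with
gradients tending uniformly to zero. -/
lemma exists_cutoff : ∃ c : ℝ, 0 ≤ c ∧ ∃ χ : ℕ → Pt → ℝ, (∀ n, HasCompactSupport (χ n)) ∧
    (∀ n, ContDiff ℝ (⊤ : ℕ∞) (χ n)) ∧ (∀ n x, |χ n x| ≤ 1) ∧
    (∀ n i x, |pd i (χ n) x| ≤ c / (n + 1)) ∧
    ∀ x, Tendsto (fun n => χ n x) atTop (nhds 1) := by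
  let f : ContDiffBump (0 : Pt) := ⟨1, 2, one_pos, one_lt_two⟩
  have hf : ContDiff ℝ (⊤ : ℕ∞) (f : Pt → ℝ) := f.contDiff
  have hs : IsSchwartz f := .of_hasCompactSupport f.hasCompactSupport hf
  choose c hc0 hc using fun i => (hs.pd i).bounded
  have hr : ∀ n : ℕ, ((n : ℝ) + 1)⁻¹ ≠ 0 := fun n => by positivity
  refine ⟨∑ i, c i, Finset.sum_nonneg fun i _ => hc0 i, fun n x => f (((n : ℝ) + 1)⁻¹ • x),
    fun n => f.hasCompactSupport.comp_smul (hr n),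
    fun n => hf.comp (contDiff_const_smul _), fun n x => ?_, fun n i x => ?_, fun x => ?_⟩
  · rw [abs_of_nonneg f.nonneg]
    exact f.le_one
  · have e : pd i (fun x => f (((n : ℝ) + 1)⁻¹ • x)) x
        = ((n : ℝ) + 1)⁻¹ * pd i f (((n : ℝ) + 1)⁻¹ • x) := by
      simp only [pd]
      rw [fderiv_comp_smul]
      simp
    rw [e, abs_mul, abs_of_nonneg (by positivity : (0 : ℝ) ≤ ((n : ℝ) + 1)⁻¹), div_eq_inv_mul]
    refine mul_le_mul_of_nonneg_left ?_ (by positivity)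
    exact (hc i _).trans (Finset.single_le_sum (f := c) (fun i _ => hc0 i) (Finset.mem_univ i))
  · refine tendsto_const_nhds.congr' ?_
    filter_upwards [eventually_ge_atTop ⌈‖x‖⌉₊] with n hn
    refine (f.one_of_mem_closedBall ?_).symm
    have : ‖x‖ ≤ n := Nat.ceil_le.1 hn
    rw [mem_closedBall_zero_iff, norm_smul, norm_inv, Real.norm_of_nonneg (by positivity)]
    exact inv_mul_le_one_of_le₀ (by linarith) (by positivity)

section Time

variable {T : ℝ} {f g : ℝ → Pt → ℝ}

namespace SmoothOn2

lemma mul {s : Set ℝ} (hf : SmoothOn2 s f) (hg : SmoothOn2 s g) :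
    SmoothOn2 s (fun t x => f t x * g t x) := ContDiffOn.mul hf hg

lemma add {s : Set ℝ} (hf : SmoothOn2 s f) (hg : SmoothOn2 s g) :
    SmoothOn2 s (fun t x => f t x + g t x) := ContDiffOn.add hf hg

lemma const_mul {s : Set ℝ} (hf : SmoothOn2 s f) (c : ℝ) :
    SmoothOn2 s (fun t x => c * f t x) := ContDiffOn.mul contDiffOn_const hf

lemma sq {s : Set ℝ} (hf : SmoothOn2 s f) : SmoothOn2 s (fun t x => f t x ^ 2) :=
  ContDiffOn.pow hf 2

lemma sum {s : Set ℝ} {ι : Type*} {A : Finset ι} {F : ι → ℝ → Pt → ℝ}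
    (h : ∀ i ∈ A, SmoothOn2 s (F i)) : SmoothOn2 s (fun t x => ∑ i ∈ A, F i t x) :=
  ContDiffOn.sum h

lemma pd (hT : 0 < T) (hf : SmoothOn2 (Icc 0 T) f) (i : Fin 3) :
    SmoothOn2 (Icc 0 T) (fun t => _root_.pd i (f t)) := by
  have hu : UniqueDiffOn ℝ (Icc 0 T ×ˢ (univ : Set Pt)) :=
    (uniqueDiffOn_Icc hT).prod uniqueDiffOn_univ
  have h1 : ContDiffOn ℝ (⊤ : ℕ∞) (fun q => fderivWithin ℝ (fun q : ℝ × Pt => f q.1 q.2)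
      (Icc 0 T ×ˢ (univ : Set Pt)) q (0, Pi.single i 1)) (Icc 0 T ×ˢ (univ : Set Pt)) :=
    (ContDiffOn.fderivWithin (m := (⊤ : ℕ∞)) hf hu (by simp)).clm_apply contDiffOn_const
  refine h1.congr fun q hq => ?_
  have hd : HasFDerivWithinAt (fun q : ℝ × Pt => f q.1 q.2)
      (fderivWithin ℝ (fun q : ℝ × Pt => f q.1 q.2) (Icc 0 T ×ˢ (univ : Set Pt)) q)
      (Icc 0 T ×ˢ (univ : Set Pt)) (q.1, q.2) :=
    (ContDiffOn.differentiableOn hf (by simp) q hq).hasFDerivWithinAt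
  have hl : HasFDerivWithinAt (fun y : Pt => (q.1, y)) (ContinuousLinearMap.inr ℝ ℝ Pt) univ q.2 :=
    (hasFDerivAt_prodMk_right q.1 q.2).hasFDerivWithinAt
  have hc := HasFDerivWithinAt.comp q.2 hd hl fun y _ => ⟨hq.1, mem_univ y⟩
  rw [hasFDerivWithinAt_univ] at hc
  have e : fderiv ℝ (f q.1) q.2 = _ := hc.fderiv
  simp only [_root_.pd]
  rw [e]
  simp

lemma contDiffAt (hf : SmoothOn2 (Icc 0 T) f) {t : ℝ} (ht : t ∈ Ioo 0 T) (x : Pt) :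
    ContDiffAt ℝ (⊤ : ℕ∞) (fun q : ℝ × Pt => f q.1 q.2) (t, x) :=
  ContDiffOn.contDiffAt hf (prod_mem_nhds (Icc_mem_nhds ht.1 ht.2) univ_mem)

lemma hasDerivAt_pd (hf : SmoothOn2 (Icc 0 T) f) {b : ℝ → Pt → ℝ}
    (hb : ∀ t ∈ Ioo 0 T, ∀ x, HasDerivAt (fun τ => f τ x) (b t x) t) (i : Fin 3)
    (t : ℝ) (ht : t ∈ Ioo 0 T) (x : Pt) :
    HasDerivAt (fun τ => _root_.pd i (f τ) x) (_root_.pd i (b t) x) t := by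
  set F : ℝ × Pt → ℝ := fun q => f q.1 q.2 with hF
  have hd : ∀ τ ∈ Ioo 0 T, ∀ y, HasFDerivAt F (fderiv ℝ F (τ, y)) (τ, y) := fun τ hτ y =>
    ((hf.contDiffAt hτ y).differentiableAt (by simp)).hasFDerivAt
  have e1 : ∀ τ ∈ Ioo 0 T, ∀ y, _root_.pd i (f τ) y = fderiv ℝ F (τ, y) (0, Pi.single i 1) := by
    intro τ hτ y
    have hc : HasFDerivAt (f τ) _ y := (hd τ hτ y).comp y (hasFDerivAt_prodMk_right τ y)
    simp only [_root_.pd]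
    rw [hc.fderiv]
    simp
  have e2 : ∀ y, b t y = fderiv ℝ F (t, y) (1, 0) := by
    intro y
    have hc := HasFDerivAt.comp (g := F) (f := fun τ : ℝ => (τ, y)) t (hd t ht y) (hasFDerivAt_prodMk_left t y)
    refine (hb t ht y).unique (hc.hasDerivAt.congr_deriv ?_)
    simp
  have hc := hf.contDiffAt ht x
  have hd2 : HasFDerivAt (fderiv ℝ F) (fderiv ℝ (fderiv ℝ F) (t, x)) (t, x) :=
    ((hc.fderiv_right (m := (⊤ : ℕ∞)) (by simp)).differentiableAt (by simp)).hasFDerivAt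
  have hsymm := (hc.isSymmSndFDerivAt
    (by rw [minSmoothness_of_isRCLikeNormedField]; exact WithTop.coe_le_coe.2 (le_top : (2 : ℕ∞) ≤ ⊤))).eq (1, 0) (0, Pi.single i 1)
  have r1 : HasDerivAt (fun τ => fderiv ℝ F (τ, x) (0, Pi.single i 1))
      (fderiv ℝ (fderiv ℝ F) (t, x) (1, 0) (0, Pi.single i 1)) t := by
    have hh : HasFDerivAt (fun τ => fderiv ℝ F (τ, x)) _ t :=
      hd2.comp t (hasFDerivAt_prodMk_left t x)
    simpa using (hh.clm_apply (hasFDerivAt_const ((0, Pi.single i 1) : ℝ × Pt) t)).hasDerivAt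
  have r2 : _root_.pd i (b t) x = fderiv ℝ (fderiv ℝ F) (t, x) (0, Pi.single i 1) (1, 0) := by
    have hh : HasFDerivAt (fun y => fderiv ℝ F (t, y)) _ x :=
      hd2.comp x (hasFDerivAt_prodMk_right t x)
    have hh2 := (hh.clm_apply (hasFDerivAt_const ((1, 0) : ℝ × Pt) x)).fderiv
    rw [show b t = fun y => fderiv ℝ F (t, y) (1, 0) from funext e2]
    simp only [_root_.pd]
    rw [hh2]
    simp
  rw [r2, ← hsymm]
  refine r1.congr_of_eventuallyEq ?_
  filter_upwards [Ioo_mem_nhds ht.1 ht.2] with τ hτ using e1 τ hτ x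

lemma density (hT : 0 < T) (hf : SmoothOn2 (Icc 0 T) f) :
    SmoothOn2 (Icc 0 T) (fun t => density (f t)) :=
  ((hf.pd hT 2).sq.mul (((hf.pd hT 2).pd hT 2).pd hT 2).sq).const_mul _

lemma densityRate (hT : 0 < T) (hf : SmoothOn2 (Icc 0 T) f) (hg : SmoothOn2 (Icc 0 T) g) :
    SmoothOn2 (Icc 0 T) (fun t => densityRate (f t) (g t)) :=
  (((hf.pd hT 2).mul (hg.pd hT 2)).mul (((hf.pd hT 2).pd hT 2).pd hT 2).sq).add
    (((hf.pd hT 2).sq.mul (((hf.pd hT 2).pd hT 2).pd hT 2)).mul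
      (((hg.pd hT 2).pd hT 2).pd hT 2))

lemma transport (hT : 0 < T) (hf : SmoothOn2 (Icc 0 T) f) {v : Fin 3 → ℝ → Pt → ℝ}
    (hv : ∀ j, SmoothOn2 (Icc 0 T) (v j)) :
    SmoothOn2 (Icc 0 T) (fun t => transport (f t) fun j => v j t) :=
  (SmoothOn2.sum fun i _ => (hv i).mul (hf.pd hT i)).add (hv 2)

lemma target (hT : 0 < T) (hf : SmoothOn2 (Icc 0 T) f) {v : Fin 3 → ℝ → Pt → ℝ}
    (hv : ∀ j, SmoothOn2 (Icc 0 T) (v j)) :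
    SmoothOn2 (Icc 0 T) (fun t => target (f t) fun j => v j t) :=
  ((hf.pd hT 2).mul ((hv 2).pd hT 2)).mul (((hf.pd hT 2).pd hT 2).pd hT 2).sq

lemma hasDerivAt_density (hT : 0 < T) (hf : SmoothOn2 (Icc 0 T) f) {b : ℝ → Pt → ℝ}
    (hb : ∀ t ∈ Ioo 0 T, ∀ x, HasDerivAt (fun τ => f τ x) (b t x) t)
    (t : ℝ) (ht : t ∈ Ioo 0 T) (x : Pt) :
    HasDerivAt (fun τ => _root_.density (f τ) x) (_root_.densityRate (f t) (b t) x) t := by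
  have h1 := hf.hasDerivAt_pd hb 2
  have h2 := (hf.pd hT 2).hasDerivAt_pd h1 2
  have h3 := ((hf.pd hT 2).pd hT 2).hasDerivAt_pd h2 2
  have h := (((h1 t ht x).pow 2).mul ((h3 t ht x).pow 2)).const_mul (1 / 2 : ℝ)
  refine h.congr_deriv ?_
  simp only [_root_.densityRate, Pi.pow_apply]
  push_cast
  ring

/-- A function smooth on the slab is integrable against a compactly supported cutoff. -/
lemma integrable_cutoff (hT : 0 < T) (hf : SmoothOn2 (Icc 0 T) f) {χ : Pt → ℝ}
    (hχ : Continuous χ) (hc : HasCompactSupport χ) :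
    Integrable (Function.uncurry fun t x => χ x * f t x)
      ((volume.restrict (Set.uIoc 0 T)).prod volume) := by
  have hcomp : IsCompact (Icc 0 T ×ˢ tsupport χ) := isCompact_Icc.prod hc
  have hcont : ContinuousOn (Function.uncurry fun t x => χ x * f t x) (Icc 0 T ×ˢ tsupport χ) :=
    (hχ.comp continuous_snd).continuousOn.mul
      ((ContDiffOn.continuousOn hf).mono (prod_mono subset_rfl (subset_univ _)))
  have h1 : IntegrableOn (Function.uncurry fun t x => χ x * f t x) (Icc 0 T ×ˢ tsupport χ)
      (volume.prod volume) := hcont.integrableOn_compact hcomp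
  have h2 : IntegrableOn (Function.uncurry fun t x => χ x * f t x) (Icc 0 T ×ˢ univ)
      (volume.prod volume) := by
    refine h1.of_forall_sdiff_eq_zero (measurableSet_Icc.prod MeasurableSet.univ) ?_
    rintro ⟨t, x⟩ ⟨h, h'⟩
    have : x ∉ tsupport χ := fun hx => h' ⟨h.1, hx⟩
    simp [Function.uncurry, image_eq_zero_of_notMem_tsupport this]
  have h3 := h2.mono_set (s := Ioc 0 T ×ˢ univ) (prod_mono Ioc_subset_Icc_self subset_rfl)
  rw [uIoc_of_le hT.le]
  rwa [IntegrableOn, ← Measure.prod_restrict, Measure.restrict_univ] at h3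

lemma intervalIntegrable_cutoff (hT : 0 < T) (hf : SmoothOn2 (Icc 0 T) f) {χ : Pt → ℝ}
    (hχ : Continuous χ) (hc : HasCompactSupport χ) :
    IntervalIntegrable (fun t => ∫ x, χ x * f t x) volume 0 T := by
  rw [intervalIntegrable_iff]
  exact (hf.integrable_cutoff hT hχ hc).integral_prod_left

/-- The fundamental theorem of calculus in time, integrated against a cutoff in space. -/
lemma integral_integral_cutoff (hT : 0 < T) (hf : SmoothOn2 (Icc 0 T) f)
    (hg : SmoothOn2 (Icc 0 T) g)
    (h : ∀ t ∈ Ioo 0 T, ∀ x, HasDerivAt (fun τ => f τ x) (g t x) t) {χ : Pt → ℝ}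
    (hχ : Continuous χ) (hc : HasCompactSupport χ) :
    ∫ t in (0:ℝ)..T, ∫ x, χ x * g t x = ∫ x, χ x * (f T x - f 0 x) := by
  have hline : ∀ {p : ℝ → Pt → ℝ}, SmoothOn2 (Icc 0 T) p → ∀ x,
      ContinuousOn (fun t => p t x) (Icc 0 T) := fun hp x =>
    (ContDiffOn.continuousOn hp).comp (f := fun t : ℝ => (t, x))
      (by fun_prop) fun t ht => ⟨ht, mem_univ x⟩
  rw [intervalIntegral_integral_swap (hg.integrable_cutoff hT hχ hc)]
  congr 1
  funext x
  rw [intervalIntegral.integral_const_mul,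
    intervalIntegral.integral_eq_sub_of_hasDerivAt_of_le hT.le (hline hf x)
      (fun t ht => h t ht x) (by
        refine ContinuousOn.intervalIntegrable ?_
        rw [uIcc_of_le hT.le]
        exact hline hg x)]

end SmoothOn2

end Time

lemma densityRate_neg (a b : Pt → ℝ) (x : Pt) :
    densityRate a (fun y => - b y) x = -1 * densityRate a b x := by
  simp only [densityRate, pd_neg]
  ring

section Bounds

variable {T : ℝ} {ψ : ℝ → Pt → ℝ} {v : Fin 3 → ℝ → Pt → ℝ}

lemma BTsq_nonneg (T : ℝ) (ψ : ℝ → Pt → ℝ) (v : Fin 3 → ℝ → Pt → ℝ) : 0 ≤ BTsq T ψ v := by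
  unfold BTsq
  positivity

lemma BT_nonneg (T : ℝ) (ψ : ℝ → Pt → ℝ) (v : Fin 3 → ℝ → Pt → ℝ) : 0 ≤ BT T ψ v :=
  Real.sqrt_nonneg _

lemma BT_sq (T : ℝ) (ψ : ℝ → Pt → ℝ) (v : Fin 3 → ℝ → Pt → ℝ) :
    BT T ψ v ^ 2 = BTsq T ψ v := Real.sq_sqrt (BTsq_nonneg T ψ v)

lemma l2T_sqrt_sq (hT : 0 < T) {g : ℝ → ℝ} (hg : ∀ t, 0 ≤ g t) :
    (l2T T fun t => Real.sqrt (g t)) ^ 2 = ∫ t in (0:ℝ)..T, g t := by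
  unfold l2T
  simp only [Real.sq_sqrt (hg _)]
  exact Real.sq_sqrt (intervalIntegral.integral_nonneg hT.le fun t _ => hg t)

lemma FiniteClass.sqrt_vecHSq_le (h : FiniteClass T ψ v) {t : ℝ} (ht : t ∈ Icc 0 T) :
    Real.sqrt (vecHSq 2 fun j => v j t) ≤ BT T ψ v := by
  have h1 := le_csSup h.1 (mem_image_of_mem (fun t => Real.sqrt (vecHSq 2 fun j => v j t)) ht)
  refine Real.le_sqrt_of_sq_le ((pow_le_pow_left₀ (Real.sqrt_nonneg _) h1 2).trans ?_)
  simp only [BTsq, supT]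
  nlinarith [sq_nonneg (sSup ((fun t => Real.sqrt (gradHSq 2 (ψ t))) '' Icc 0 T)),
    sq_nonneg (l2T T fun t => Real.sqrt (gradVecHSq 2 fun j => v j t)),
    sq_nonneg (l2T T fun t => Real.sqrt (gradHHSq 1 (ψ t)))]

lemma FiniteClass.sqrt_gradHSq_le (h : FiniteClass T ψ v) {t : ℝ} (ht : t ∈ Icc 0 T) :
    Real.sqrt (gradHSq 2 (ψ t)) ≤ BT T ψ v := by
  have h1 := le_csSup h.2.1 (mem_image_of_mem (fun t => Real.sqrt (gradHSq 2 (ψ t))) ht)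
  refine Real.le_sqrt_of_sq_le ((pow_le_pow_left₀ (Real.sqrt_nonneg _) h1 2).trans ?_)
  simp only [BTsq, supT]
  nlinarith [sq_nonneg (sSup ((fun t => Real.sqrt (vecHSq 2 fun j => v j t)) '' Icc 0 T)),
    sq_nonneg (l2T T fun t => Real.sqrt (gradVecHSq 2 fun j => v j t)),
    sq_nonneg (l2T T fun t => Real.sqrt (gradHHSq 1 (ψ t)))]

lemma integral_gradHHSq_add_gradVecHSq_le (hT : 0 < T) :
    (∫ t in (0:ℝ)..T, gradHHSq 1 (ψ t)) + ∫ t in (0:ℝ)..T, gradVecHSq 2 (fun j => v j t)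
      ≤ BT T ψ v ^ 2 := by
  rw [BT_sq, BTsq, l2T_sqrt_sq hT fun t => gradHHSq_nonneg 1 (ψ t),
    l2T_sqrt_sq hT fun t => gradVecHSq_nonneg 2 fun j => v j t]
  nlinarith [sq_nonneg (supT T fun t => Real.sqrt (gradHSq 2 (ψ t))),
    sq_nonneg (supT T fun t => Real.sqrt (vecHSq 2 fun j => v j t))]

/-- The transport equation as a derivative in time. -/
lemma TransportEq.hasDerivAt (h : TransportEq (Icc 0 T) ψ v) (hψ : SmoothOn2 (Icc 0 T) ψ)
    (t : ℝ) (ht : t ∈ Ioo 0 T) (x : Pt) :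
    HasDerivAt (fun τ => ψ τ x) (- transport (ψ t) (fun j => v j t) x) t := by
  have hd : DifferentiableAt ℝ (fun τ => ψ τ x) t :=
    ((hψ.contDiffAt ht x).differentiableAt (by simp)).comp
      (g := fun q : ℝ × Pt => ψ q.1 q.2) (f := fun τ : ℝ => (τ, x)) t (by fun_prop)
  refine hd.hasDerivAt.congr_deriv ?_
  have := h t (Ioo_subset_Icc_self ht) x
  unfold transport
  linarith

lemma abs_integral_integral_cutoff_target_le (hT : 0 < T) (hψ : SmoothOn2 (Icc 0 T) ψ)
    (hv : ∀ j, SmoothOn2 (Icc 0 T) (v j))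
    (hS : ∀ t ∈ Icc (0:ℝ) T, IsSchwartz (ψ t) ∧ ∀ j, IsSchwartz (v j t))
    (hdiv : DivFree (Icc 0 T) v) (htr : TransportEq (Icc 0 T) ψ v) (hfin : FiniteClass T ψ v)
    {χ : Pt → ℝ} {L : ℝ} (hχ : ContDiff ℝ (⊤ : ℕ∞) χ) (hc : HasCompactSupport χ)
    (hχ1 : ∀ x, |χ x| ≤ 1) (hL : ∀ i x, |pd i χ x| ≤ L) :
    |∫ t in (0:ℝ)..T, ∫ x, χ x * target (ψ t) (fun j => v j t) x|
      ≤ 10 ^ 9 * BT T ψ v ^ 4 * (1 + BT T ψ v) + T * (1687296 * BT T ψ v ^ 5) * L := by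
  have hB0 := BT_nonneg T ψ v
  have hA := fun t ht => hfin.sqrt_gradHSq_le (t := t) ht
  have hV := fun t ht => hfin.sqrt_vecHSq_le (t := t) ht
  have hHW := integral_gradHHSq_add_gradVecHSq_le (ψ := ψ) (v := v) hT
  set B := BT T ψ v
  have hL0 : 0 ≤ L := (abs_nonneg _).trans (hL 0 0)
  have hχS : IsSchwartz χ := .of_hasCompactSupport hc hχ
  set r : ℝ → Pt → ℝ := fun t x => densityRate (ψ t) (transport (ψ t) fun j => v j t) x with hr
  have hrs : SmoothOn2 (Icc 0 T) r := hψ.densityRate hT (hψ.transport hT hv)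
  have hFTC := (hψ.density hT).integral_integral_cutoff hT (hrs.const_mul (-1))
    (fun t ht x => (hψ.hasDerivAt_density hT (htr.hasDerivAt hψ) t ht x).congr_deriv
      (densityRate_neg _ _ x)) hχ.continuous hc
  have hP : ∀ t ∈ Icc 0 T, |∫ x, χ x * density (ψ t) x| ≤ 5408 * B ^ 4 := by
    intro t ht
    have hp := isSchwartz_density (hS t ht).1
    refine abs_integral_le_integral_abs.trans ((integral_mono (hχS.mul hp).integrable.abs
      hp.integrable fun x => ?_).trans ((integral_density_le (hS t ht).1).trans ?_))
    · simp only
      rw [abs_mul, abs_of_nonneg (density_nonneg _ x)]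
      exact mul_le_of_le_one_left (density_nonneg _ x) (hχ1 x)
    · have := hA t ht
      gcongr
  have h0 : (0:ℝ) ∈ Icc 0 T := ⟨le_rfl, hT.le⟩
  have hT' : T ∈ Icc 0 T := ⟨hT.le, le_rfl⟩
  have hR : |∫ t in (0:ℝ)..T, ∫ x, χ x * r t x| ≤ 10816 * B ^ 4 := by
    have e : ∫ t in (0:ℝ)..T, ∫ x, χ x * r t x
        = (∫ x, χ x * density (ψ 0) x) - ∫ x, χ x * density (ψ T) x := by
      rw [← integral_sub (hχS.mul (isSchwartz_density (hS 0 h0).1)).integrable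
        (hχS.mul (isSchwartz_density (hS T hT').1)).integrable]
      have e1 : ∀ t, ∫ x, χ x * (-1 * r t x) = - ∫ x, χ x * r t x := by
        intro t
        rw [← integral_neg]
        congr 1
        funext x
        ring
      simp only [e1, intervalIntegral.integral_neg] at hFTC
      rw [← neg_eq_iff_eq_neg.2 hFTC.symm, ← integral_neg]
      congr 1
      funext x
      ring
    rw [e]
    refine (abs_sub _ _).trans ?_
    linarith [hP 0 h0, hP T hT']
  have iJ := (hψ.target hT hv).intervalIntegrable_cutoff hT hχ.continuous hc
  have iR := hrs.intervalIntegrable_cutoff hT hχ.continuous hc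
  have iH := hfin.2.2.2
  have iW := hfin.2.2.1
  have hpt : ∀ t ∈ Icc 0 T,
      |(∫ x, χ x * target (ψ t) (fun j => v j t) x) - ∫ x, χ x * r t x| ≤
      (10 ^ 8 * (B ^ 2 * (1 + B))) * (gradHHSq 1 (ψ t) + gradVecHSq 2 fun j => v j t)
        + 1687296 * B ^ 5 * L := by
    intro t ht
    refine (abs_integral_cutoff_target_sub_le (hS t ht).1 (hS t ht).2 hχS hχ1
      (fun x => hdiv t ht x) hL).trans (add_le_add ?_ ?_)
    · have := hA t ht
      have h1 : Real.sqrt (gradHHSq 1 (ψ t)) * Real.sqrt (gradVecHSq 2 fun j => v j t)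
          ≤ gradHHSq 1 (ψ t) + gradVecHSq 2 fun j => v j t := by
        have a1 := Real.sq_sqrt (gradHHSq_nonneg 1 (ψ t))
        have a2 := Real.sq_sqrt (gradVecHSq_nonneg 2 fun j => v j t)
        nlinarith [sq_nonneg (Real.sqrt (gradHHSq 1 (ψ t))
          - Real.sqrt (gradVecHSq 2 fun j => v j t)), gradHHSq_nonneg 1 (ψ t),
          gradVecHSq_nonneg 2 fun j => v j t]
      rw [mul_assoc (10 ^ 8 : ℝ) (B ^ 2 * (1 + B))]
      gcongr
    · have := hA t ht
      have := hV t ht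
      calc _ ≤ 3 * (104 * B) * L * (5408 * B ^ 4) := by gcongr
        _ = _ := by ring
  have hD : |∫ t in (0:ℝ)..T, ((∫ x, χ x * target (ψ t) (fun j => v j t) x)
      - ∫ x, χ x * r t x)| ≤ (10 ^ 8 * (B ^ 2 * (1 + B))) * B ^ 2 + T * (1687296 * B ^ 5 * L) := by
    refine (intervalIntegral.abs_integral_le_integral_abs hT.le).trans
      ((intervalIntegral.integral_mono_on hT.le (iJ.sub iR).abs
        (((iH.add iW).const_mul _).add intervalIntegrable_const) hpt).trans ?_)
    rw [intervalIntegral.integral_add ((iH.add iW).const_mul _) intervalIntegrable_const,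
      intervalIntegral.integral_const_mul, intervalIntegral.integral_add iH iW,
      intervalIntegral.integral_const, smul_eq_mul, sub_zero]
    gcongr
  rw [intervalIntegral.integral_sub iJ iR] at hD
  have h4 : 0 ≤ B ^ 4 := by positivity
  have h5 : 0 ≤ B ^ 5 := by positivity
  have := abs_sub_abs_le_abs_sub (∫ t in (0:ℝ)..T, ∫ x, χ x * target (ψ t) (fun j => v j t) x)
    (∫ t in (0:ℝ)..T, ∫ x, χ x * r t x)
  nlinarith

end Bounds

/-- Lemma A.1 (Lemma 2.2-2 in the paper):
`|∫₀^T∫ ∂₃ψ ∂₃v₃ (∂₃³ψ)²| ≤ C B_T⁴ (1 + B_T)`. -/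
theorem stmt_11 :
    ∃ C : ℝ, 0 < C ∧ ∀ T : ℝ, 0 < T → ∀ (ψ : ℝ → Pt → ℝ) (v : Fin 3 → ℝ → Pt → ℝ),
      SmoothOn2 (Icc 0 T) ψ → (∀ j, SmoothOn2 (Icc 0 T) (v j)) →
      (∀ t ∈ Icc (0:ℝ) T, IsSchwartz (ψ t) ∧ ∀ j, IsSchwartz (v j t)) →
      DivFree (Icc 0 T) v → TransportEq (Icc 0 T) ψ v → FiniteClass T ψ v →
      |∫ t in (0:ℝ)..T, ∫ x : Pt,
          pd 2 (ψ t) x * pd 2 (v 2 t) x * (pd 2 (pd 2 (pd 2 (ψ t))) x) ^ 2| ≤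
        C * BT T ψ v ^ 4 * (1 + BT T ψ v) := by
  refine ⟨10 ^ 9, by norm_num, fun T hT ψ v hψ hv hS hdiv htr hfin => ?_⟩
  obtain ⟨c, hc0, χ, hχc, hχ, hχ1, hL, hlim⟩ := exists_cutoff
  have hB0 := BT_nonneg T ψ v
  have hJ : Tendsto (fun n => ∫ t in (0:ℝ)..T, ∫ x, χ n x * target (ψ t) (fun j => v j t) x)
      atTop (nhds (∫ t in (0:ℝ)..T, ∫ x, target (ψ t) (fun j => v j t) x)) := by
    refine intervalIntegral.tendsto_integral_filter_of_dominated_convergence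
      (fun t => 10816 * BT T ψ v ^ 3 * (1 + gradVecHSq 2 fun j => v j t))
      (Eventually.of_forall fun n => ?_) (Eventually.of_forall fun n => ae_of_all _ fun t ht => ?_)
      ((intervalIntegrable_const.add hfin.2.2.1).const_mul _) (ae_of_all _ fun t ht => ?_)
    · exact ((intervalIntegrable_iff.1 ((hψ.target hT hv).intervalIntegrable_cutoff hT
        (hχ n).continuous (hχc n)))).aestronglyMeasurable
    · rw [uIoc_of_le hT.le] at ht
      have ht' := Ioc_subset_Icc_self ht
      have hg := isSchwartz_target (hS t ht').1 (hS t ht').2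
      have hχS : IsSchwartz (χ n) := .of_hasCompactSupport (hχc n) (hχ n)
      rw [Real.norm_eq_abs]
      refine abs_integral_le_integral_abs.trans ((integral_mono (hχS.mul hg).integrable.abs
        hg.integrable.abs fun x => ?_).trans ((integral_abs_target_le (hS t ht').1
        (hS t ht').2).trans ?_))
      · simp only
        rw [abs_mul]
        exact mul_le_of_le_one_left (abs_nonneg _) (hχ1 n x)
      · have hA := hfin.sqrt_gradHSq_le ht'
        have hW : Real.sqrt (gradVecHSq 2 fun j => v j t)
            ≤ 1 + gradVecHSq 2 fun j => v j t := by
          have := Real.sq_sqrt (gradVecHSq_nonneg 2 fun j => v j t)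
          nlinarith [sq_nonneg (Real.sqrt (gradVecHSq 2 fun j => v j t) - 1)]
        rw [mul_assoc]
        gcongr
    · rw [uIoc_of_le hT.le] at ht
      have ht' := Ioc_subset_Icc_self ht
      have hg := isSchwartz_target (hS t ht').1 (hS t ht').2
      refine tendsto_integral_of_dominated_convergence _ (fun n => ?_) hg.integrable.abs
        (fun n => ae_of_all _ fun x => ?_) (ae_of_all _ fun x => ?_)
      · exact ((hχ n).continuous.mul hg.continuous).aestronglyMeasurable
      · rw [Real.norm_eq_abs, abs_mul]
        exact mul_le_of_le_one_left (abs_nonneg _) (hχ1 n x)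
      · simpa using (hlim x).mul_const (target (ψ t) (fun j => v j t) x)
  have hbound : Tendsto (fun n : ℕ => 10 ^ 9 * BT T ψ v ^ 4 * (1 + BT T ψ v)
      + T * (1687296 * BT T ψ v ^ 5) * (c / (n + 1))) atTop
      (nhds (10 ^ 9 * BT T ψ v ^ 4 * (1 + BT T ψ v))) := by
    have h := ((tendsto_one_div_add_atTop_nhds_zero_nat (𝕜 := ℝ)).const_mul c).const_mul
      (T * (1687296 * BT T ψ v ^ 5))
    simp only [mul_one_div, mul_zero] at h
    simpa using h.const_add (10 ^ 9 * BT T ψ v ^ 4 * (1 + BT T ψ v))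
  exact le_of_tendsto_of_tendsto' hJ.abs hbound fun n =>
    abs_integral_integral_cutoff_target_le hT hψ hv hS hdiv htr hfin (hχ n) (hχc n) (hχ1 n) (hL n)

end
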